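/- Let G and H be modules over Z_p (the integers localized at a prime p), each having a partial decomposition basis. Then G ≅_p H (G and H are partially isomorphic) if and only if: û(α,G) = û(α,H) for every α that is an ordinal or the symbol ∞, and ŵ(e,G) = ŵ(e,H) for every equivalence class e of Ulm sequences. -/

import Mathlib

noncomputable section

namespace UlmW

universe u

variable {R : Type*} [CommRing R]

/-- The submodule `p^α M`, defined by transfinite recursion on `α`. -/
def ppow {M : Type u} [AddCommGroup M] [Module R M] (p : R) (α : Ordinal.{u}) :
    Submodule R M :=
  Ordinal.limitRecOn α ⊤ (fun _ S => Submodule.map (LinearMap.lsmul R M p) S)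
    fun β _ ih => ⨅ (γ : Set.Iio β), ih γ.1 γ.2

open scoped Classical in
/-- The `p`-height of `x`, with `⊤` playing the role of `∞`. -/
def pheight {M : Type u} [AddCommGroup M] [Module R M] (p : R) (x : M) :
    WithTop Ordinal.{u} :=
  if h : ∃ α : Ordinal.{u}, x ∈ ppow p α ∧ x ∉ ppow p (α + 1) then (h.choose : WithTop Ordinal)
  else ⊤

/-- `H⁰ = {x : ∃ a ≠ 0, a • x ∈ H}`. -/
def hull {M : Type u} [AddCommGroup M] [Module R M] (H : Submodule R M) : Set M :=
  {x | ∃ a : R, a ≠ 0 ∧ a • x ∈ H}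

/-- `X` is a decomposition set with respect to the single prime `p`. -/
def IsDecompWrt {M : Type u} [AddCommGroup M] [Module R M] (p : R) (X : Set M) : Prop :=
  (LinearIndependent R (fun x : X => (x : M))) ∧
  (∀ x ∈ X, ∀ a : R, a ≠ 0 → a • x ≠ 0) ∧
  (∀ s : Finset M, ↑s ⊆ X → ∀ c : M → R,
    pheight p (∑ x ∈ s, c x • x) = s.inf fun x => pheight p (c x • x))

/-- `X` is a decomposition set (with respect to every prime of `R`). -/
def IsDecompositionSet (R : Type*) [CommRing R] {M : Type u} [AddCommGroup M] [Module R M]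
    (X : Set M) : Prop :=
  ∀ p : R, Prime p → IsDecompWrt p X

/-- partial decomposition basis, heights taken w.r.t. a fixed prime `p`. -/
def IsPDBWrt {M : Type u} [AddCommGroup M] [Module R M] (p : R) (C : Set (Set M)) : Prop :=
  C.Nonempty ∧ (∀ X ∈ C, X.Finite) ∧ (∀ X ∈ C, IsDecompWrt p X) ∧
  ∀ X ∈ C, ∀ x : M, ∃ Y ∈ C, X ⊆ Y ∧ x ∈ hull (Submodule.span R Y)

/-- partial decomposition basis (heights w.r.t. all primes of `R`). -/
def IsPDB (R : Type*) [CommRing R] {M : Type u} [AddCommGroup M] [Module R M] (C : Set (Set M)) : Prop :=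
  C.Nonempty ∧ (∀ X ∈ C, X.Finite) ∧ (∀ X ∈ C, IsDecompositionSet R X) ∧
  ∀ X ∈ C, ∀ x : M, ∃ Y ∈ C, X ⊆ Y ∧ x ∈ hull (Submodule.span R Y)

/-- A partial isomorphism system `I : G ≅_p H`. -/
def IsPartialIsoSystem {M N : Type*} [AddCommGroup M] [Module R M]
    [AddCommGroup N] [Module R N] (I : Set (M →ₗ.[R] N)) : Prop :=
  I.Nonempty ∧
  (∀ f ∈ I, Function.Injective f.toFun) ∧
  (∀ f ∈ I, ∀ a : M, ∃ g ∈ I, f ≤ g ∧ a ∈ g.domain) ∧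
  (∀ f ∈ I, ∀ b : N, ∃ g ∈ I, f ≤ g ∧ ∃ y : g.domain, g y = b)

/-- The Ulm sequence of `x`: `U(x) = (|pⁱ x|)ᵢ`. -/
def UlmSeqOf {M : Type u} [AddCommGroup M] [Module R M] (p : R) (x : M) :
    ℕ → WithTop Ordinal.{u} :=
  fun i => pheight p ((p ^ i) • x)

/-- `u` is an Ulm sequence. -/
def IsUlmSeq (u : ℕ → WithTop Ordinal.{u}) : Prop :=
  ∀ i, (u i = ⊤ → u (i + 1) = ⊤) ∧ (u i ≠ ⊤ → u i < u (i + 1))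

/-- Equivalence of Ulm sequences. -/
def UlmEquiv (u v : ℕ → WithTop Ordinal.{u}) : Prop :=
  ∃ m n : ℕ, ∀ i, u (i + n) = v (i + m)

/-- `X` contains at least `n` elements whose Ulm sequence is equivalent to `u`. -/
def HasAtLeast {M : Type u} [AddCommGroup M] [Module R M] (p : R)
    (u : ℕ → WithTop Ordinal.{u}) (n : ℕ) (X : Set M) : Prop :=
  ∃ s : Finset M, ↑s ⊆ X ∧ n ≤ s.card ∧ ∀ x ∈ s, UlmEquiv (UlmSeqOf p x) u

/-- `ŵ_C(e,G)` where `e` is the class of the Ulm sequence `u`. -/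
def wHat {M : Type u} [AddCommGroup M] [Module R M] (p : R) (C : Set (Set M))
    (u : ℕ → WithTop Ordinal.{u}) : ℕ∞ :=
  sSup {N : ℕ∞ | ∃ n : ℕ, N = (n : ℕ∞) ∧ ∃ X ∈ C, HasAtLeast p u n X}

/-- `x` is proper with respect to `S`. -/
def IsProper {M : Type u} [AddCommGroup M] [Module R M] (p : R) (S : Submodule R M)
    (x : M) : Prop :=
  ∀ s ∈ S, pheight p (x + s) ≤ pheight p x

/-- `H` is a nice submodule. -/
def IsNice {M : Type u} [AddCommGroup M] [Module R M] (p : R) (H : Submodule R M) : Prop :=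
  ∀ x : M, ∃ h ∈ H, ∀ h' ∈ H, pheight p (x + h') ≤ pheight p (x + h)

/-- The Ulm invariant `u_p(σ, M)`: the dimension of `(p^σ M)[p]/(p^{σ+1} M)[p]`
over the residue field `R/(p)`. -/
def uCard (p : R) (M : Type u) [AddCommGroup M] [Module R M] (σ : Ordinal.{u}) :
    Cardinal :=
  let V : Submodule R M := ppow p σ ⊓ Submodule.torsionBy R M p
  let W : Submodule R V := (ppow p (σ + 1) ⊓ Submodule.torsionBy R M p).comap V.subtype
  Module.rank (R ⧸ Ideal.span {p})
    ((V ⧸ W) ⧸ (Ideal.span {p} • (⊤ : Submodule R (V ⧸ W))))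

/-- `û_p(σ, M) = min (u_p(σ, M), ω)`. -/
def uHat (p : R) (M : Type u) [AddCommGroup M] [Module R M] (σ : Ordinal.{u}) : Cardinal :=
  min (uCard p M σ) Cardinal.aleph0

/-- `û_p(∞, M) = min (dim (p^∞ M)[p], ω)`. -/
def uHatInf (p : R) (M : Type u) [AddCommGroup M] [Module R M] : Cardinal :=
  let V : Submodule R M := (⨅ α : Ordinal.{u}, ppow p α) ⊓ Submodule.torsionBy R M p
  min (Module.rank (R ⧸ Ideal.span {p})
    (V ⧸ (Ideal.span {p} • (⊤ : Submodule R V)))) Cardinal.aleph0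

end UlmW

open UlmW

/-- The ideal `(p) ⊆ ℤ` is prime. -/
instance zpSpanPrime (p : ℤ) [hp : Fact (Prime p)] : (Ideal.span {p} : Ideal ℤ).IsPrime :=
  (Ideal.span_singleton_prime hp.out.ne_zero).mpr hp.out

/-- `ℤ_(p)`, the integers localized at the prime `p`. -/
abbrev Zp (p : ℤ) [Fact (Prime p)] : Type :=
  Localization.AtPrime (Ideal.span {p} : Ideal ℤ)


universe u

open UlmW

namespace UlmW

section Height

variable {R : Type*} [CommRing R] {M : Type u} [AddCommGroup M] [Module R M] {p : R}

theorem ppow_zero : ppow (M := M) p 0 = ⊤ := Ordinal.limitRecOn_zero ..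

theorem ppow_add_one (α : Ordinal.{u}) :
    ppow (M := M) p (α + 1) = (ppow p α).map (LinearMap.lsmul R M p) :=
  Ordinal.limitRecOn_add_one ..

theorem ppow_limit {α : Ordinal.{u}} (h : Order.IsSuccLimit α) :
    ppow (M := M) p α = ⨅ γ : Set.Iio α, ppow p γ.1 :=
  Ordinal.limitRecOn_limit _ _ _ _ h

theorem mem_ppow_add_one {α : Ordinal.{u}} {x : M} :
    x ∈ ppow p (α + 1) ↔ ∃ y ∈ ppow p α, p • y = x := by
  rw [ppow_add_one]; rfl

theorem mem_ppow_limit {α : Ordinal.{u}} (h : Order.IsSuccLimit α) {x : M} :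
    x ∈ ppow p α ↔ ∀ γ < α, x ∈ ppow p γ := by
  simp [ppow_limit h]

theorem ppow_add_one_le (α : Ordinal.{u}) : ppow (M := M) p (α + 1) ≤ ppow p α := by
  intro x hx
  obtain ⟨y, hy, rfl⟩ := mem_ppow_add_one.1 hx
  exact Submodule.smul_mem _ _ hy

theorem ppow_antitone : Antitone (ppow (M := M) p) := by
  intro α β hαβ
  induction β using Ordinal.limitRecOn with
  | zero => rw [nonpos_iff_eq_zero.1 hαβ]
  | add_one β ih =>
    rcases hαβ.eq_or_lt with rfl | h
    · rfl
    · exact (ppow_add_one_le β).trans (ih (Order.lt_add_one_iff.1 h))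
  | limit β hβ ih =>
    rcases hαβ.eq_or_lt with rfl | h
    · rfl
    · exact fun x hx => (mem_ppow_limit hβ).1 hx α h

theorem pheight_eq_coe {x : M} {α : Ordinal.{u}} (h₁ : x ∈ ppow p α) (h₂ : x ∉ ppow p (α + 1)) :
    pheight p x = α := by
  have h : ∃ α : Ordinal.{u}, x ∈ ppow p α ∧ x ∉ ppow p (α + 1) := ⟨α, h₁, h₂⟩
  rw [pheight, dif_pos h]
  congr 1
  apply le_antisymm
  · by_contra! hlt
    exact h₂ (ppow_antitone (Order.add_one_le_of_lt hlt) h.choose_spec.1)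
  · by_contra! hlt
    exact h.choose_spec.2 (ppow_antitone (Order.add_one_le_of_lt hlt) h₁)

theorem exists_not_mem_add_one {x : M} {α : Ordinal.{u}} (h : x ∉ ppow p α) :
    ∃ β < α, x ∈ ppow p β ∧ x ∉ ppow p (β + 1) := by
  induction α using Ordinal.limitRecOn with
  | zero => simp [ppow_zero] at h
  | add_one α ih =>
    by_cases hx : x ∈ ppow p α
    · exact ⟨α, Order.lt_add_one_iff.2 le_rfl, hx, h⟩
    · obtain ⟨β, hβ, h'⟩ := ih hx
      exact ⟨β, hβ.trans (Order.lt_add_one_iff.2 le_rfl), h'⟩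
  | limit α hα ih =>
    rw [mem_ppow_limit hα] at h
    push Not at h
    obtain ⟨γ, hγ, hx⟩ := h
    obtain ⟨β, hβ, h'⟩ := ih γ hγ hx
    exact ⟨β, hβ.trans hγ, h'⟩

theorem coe_le_pheight {x : M} {α : Ordinal.{u}} : α ≤ pheight p x ↔ x ∈ ppow p α := by
  by_cases h : ∃ β : Ordinal.{u}, x ∈ ppow p β ∧ x ∉ ppow p (β + 1)
  · obtain ⟨β, h₁, h₂⟩ := h
    rw [pheight_eq_coe h₁ h₂, WithTop.coe_le_coe]
    refine ⟨fun h => ppow_antitone h h₁, fun h => ?_⟩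
    by_contra! hlt
    exact h₂ (ppow_antitone (Order.add_one_le_of_lt hlt) h)
  · have ht : pheight p x = ⊤ := dif_neg h
    refine ⟨fun _ => ?_, fun _ => by simp [ht]⟩
    by_contra hx
    obtain ⟨β, -, hβ⟩ := exists_not_mem_add_one hx
    exact h ⟨β, hβ⟩

theorem coe_lt_pheight {x : M} {α : Ordinal.{u}} : α < pheight p x ↔ x ∈ ppow p (α + 1) := by
  rw [← coe_le_pheight]
  cases pheight p x with
  | top => simp
  | coe β => rw [WithTop.coe_lt_coe, WithTop.coe_le_coe, Order.add_one_le_iff]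

theorem pheight_eq_top {x : M} : pheight p x = ⊤ ↔ ∀ α : Ordinal.{u}, x ∈ ppow p α := by
  simp_rw [← coe_le_pheight]
  refine ⟨fun h => by simp [h], fun h => ?_⟩
  cases hx : pheight p x with
  | top => rfl
  | coe β =>
    have := h (β + 1)
    rw [hx, WithTop.coe_le_coe, Order.add_one_le_iff] at this
    exact absurd this (lt_irrefl _)

/-- Heights are determined by membership in the submodules `p^α M`. -/
theorem pheight_le_pheight {N : Type u} [AddCommGroup N] [Module R N] {x : M} {y : N}
    (h : ∀ α : Ordinal.{u}, x ∈ ppow p α → y ∈ ppow p α) : pheight p x ≤ pheight p y := by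
  cases hx : pheight p x with
  | top => exact (pheight_eq_top.2 fun α => h α (pheight_eq_top.1 hx α)).ge
  | coe β => exact coe_le_pheight.2 (h β (coe_le_pheight.1 hx.ge))

@[simp] theorem pheight_zero : pheight p (0 : M) = ⊤ :=
  pheight_eq_top.2 fun _ => zero_mem _

theorem min_le_pheight_add (x y : M) : min (pheight p x) (pheight p y) ≤ pheight p (x + y) := by
  cases h : min (pheight p x) (pheight p y) with
  | top =>
    obtain ⟨hx, hy⟩ := min_eq_top.1 h
    exact (pheight_eq_top.2 fun α =>
      add_mem (pheight_eq_top.1 hx α) (pheight_eq_top.1 hy α)).ge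
  | coe β =>
    have := le_min_iff.1 h.ge
    exact coe_le_pheight.2 (add_mem (coe_le_pheight.1 this.1) (coe_le_pheight.1 this.2))

theorem le_pheight_add {x y : M} {γ : WithTop Ordinal.{u}} (hx : γ ≤ pheight p x)
    (hy : γ ≤ pheight p y) : γ ≤ pheight p (x + y) :=
  (le_min hx hy).trans (min_le_pheight_add x y)

theorem pheight_le_smul (c : R) (x : M) : pheight p x ≤ pheight p (c • x) :=
  pheight_le_pheight fun _ h => Submodule.smul_mem _ c h

theorem pheight_unit_smul (c : Rˣ) (x : M) : pheight p ((c : R) • x) = pheight p x := by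
  refine le_antisymm ?_ (pheight_le_smul _ _)
  have := pheight_le_smul (p := p) (↑c⁻¹ : R) ((c : R) • x)
  rwa [smul_smul, Units.inv_mul, one_smul] at this

@[simp] theorem pheight_neg (x : M) : pheight p (-x) = pheight p x := by
  simpa using pheight_unit_smul (p := p) (-1 : Rˣ) x

theorem le_pheight_sub {x y : M} {γ : WithTop Ordinal.{u}} (hx : γ ≤ pheight p x)
    (hy : γ ≤ pheight p y) : γ ≤ pheight p (x - y) := by
  rw [sub_eq_add_neg]
  exact le_pheight_add hx (by simpa using hy)

theorem le_pheight_sum {ι : Type*} {s : Finset ι} {f : ι → M} {γ : WithTop Ordinal.{u}}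
    (h : ∀ i ∈ s, γ ≤ pheight p (f i)) : γ ≤ pheight p (∑ i ∈ s, f i) := by
  classical
  induction s using Finset.induction_on with
  | empty => simp
  | insert a s ha ih =>
    rw [Finset.sum_insert ha]
    exact le_pheight_add (h a (by simp)) (ih fun i hi => h i (by simp [hi]))

theorem pheight_add_of_lt {x y : M} (h : pheight p x < pheight p y) :
    pheight p (x + y) = pheight p x := by
  refine le_antisymm ?_ (le_pheight_add le_rfl h.le)
  by_contra! hlt
  have := le_pheight_sub (p := p) (x := x + y) (y := y) (min_le_left _ _) (min_le_right _ _)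
  rw [add_sub_cancel_right] at this
  exact absurd this (not_le.2 (lt_min hlt h))

/-- If `|x + y| > |y|`, then `|x| = |y|`. -/
theorem pheight_eq_of_lt_add {x y : M} (h : pheight p y < pheight p (x + y)) :
    pheight p x = pheight p y := by
  have h' : pheight p (-y) < pheight p (x + y) := by simpa using h
  simpa using pheight_add_of_lt h'

/-- If `|x + y| ≤ |y|`, then `|x + y| = min |x| |y|`. -/
theorem pheight_add_eq_min {x y : M} (h : pheight p (x + y) ≤ pheight p y) :
    pheight p (x + y) = min (pheight p x) (pheight p y) := by
  refine le_antisymm (le_min ?_ h) (min_le_pheight_add x y)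
  have := le_pheight_sub (p := p) (x := x + y) (y := y) le_rfl h
  simpa using this

theorem pheight_lt_smul {x : M} (h : pheight p x ≠ ⊤) : pheight p x < pheight p (p • x) := by
  cases hx : pheight p x with
  | top => exact absurd hx h
  | coe β =>
    exact coe_lt_pheight.2 (mem_ppow_add_one.2 ⟨x, coe_le_pheight.1 hx.ge, rfl⟩)

theorem pheight_pow_smul_lt {x : M} {m n : ℕ} (hmn : m < n) (h : pheight p (p ^ m • x) ≠ ⊤) :
    pheight p (p ^ m • x) < pheight p (p ^ n • x) := by
  obtain ⟨k, rfl⟩ := Nat.exists_eq_add_of_lt hmn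
  refine (pheight_lt_smul h).trans_le ?_
  rw [show p ^ (m + k + 1) = p ^ k * (p * p ^ m) by ring, mul_smul, mul_smul]
  exact pheight_le_smul _ _

theorem pheight_pow_smul_mono {x : M} {m n : ℕ} (hmn : m ≤ n) :
    pheight p (p ^ m • x) ≤ pheight p (p ^ n • x) := by
  obtain ⟨k, rfl⟩ := Nat.exists_eq_add_of_le hmn
  rw [show p ^ (m + k) = p ^ k * p ^ m by ring, mul_smul]
  exact pheight_le_smul _ _

theorem isUlmSeq_ulmSeqOf (x : M) : IsUlmSeq (UlmSeqOf p x) := by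
  refine fun i => ⟨fun h => ?_, fun h => pheight_pow_smul_lt (Nat.lt_succ_self i) h⟩
  exact top_le_iff.1 (h.ge.trans (pheight_pow_smul_mono (Nat.le_succ i)))

theorem exists_ppow_stable (p : R) (M : Type u) [AddCommGroup M] [Module R M] :
    ∃ α : Ordinal.{u}, ∀ β, α ≤ β → ppow (M := M) p β = ppow p α := by
  have hinj := not_injective_of_ordinal (ppow (M := M) p)
  have h : ∃ α β : Ordinal.{u}, α < β ∧ ppow (M := M) p α = ppow p β := by
    simp only [Function.Injective] at hinj
    push Not at hinj
    obtain ⟨a, b, hab, hne⟩ := hinj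
    rcases hne.lt_or_gt with h | h
    · exact ⟨a, b, h, hab⟩
    · exact ⟨b, a, h, hab.symm⟩
  obtain ⟨α, β, hαβ, heq⟩ := h
  have hs : ppow (M := M) p (α + 1) = ppow p α :=
    le_antisymm (ppow_add_one_le α)
      (heq.le.trans (ppow_antitone (Order.add_one_le_of_lt hαβ)))
  refine ⟨α, fun γ hγ => ?_⟩
  induction γ using Ordinal.limitRecOn with
  | zero => rw [nonpos_iff_eq_zero.1 hγ]
  | add_one γ ih =>
    rcases hγ.eq_or_lt with h | h
    · rw [h]
    · rw [ppow_add_one, ih (Order.lt_add_one_iff.1 h), ← ppow_add_one, hs]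
  | limit γ hlim ih =>
    refine le_antisymm (ppow_antitone hγ) fun x hx => (mem_ppow_limit hlim).2 fun δ hδ => ?_
    rcases le_total α δ with h | h
    · rwa [ih δ hδ h]
    · exact ppow_antitone h hx

/-- The submodule `p^∞ M` is `p`-divisible. -/
theorem exists_smul_eq_of_pheight_eq_top {x : M} (h : pheight p x = ⊤) :
    ∃ y : M, pheight p y = ⊤ ∧ p • y = x := by
  obtain ⟨α, hα⟩ := exists_ppow_stable p M
  obtain ⟨y, hy, rfl⟩ := mem_ppow_add_one.1 (pheight_eq_top.1 h (α + 1))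
  refine ⟨y, pheight_eq_top.2 fun β => ?_, rfl⟩
  rcases le_total α β with h | h
  · rwa [hα β h]
  · exact ppow_antitone h hy

/-- An element of height greater than `α` is divisible by `p` in `p^α M`. -/
theorem exists_smul_eq_of_lt_pheight {x : M} {α : WithTop Ordinal.{u}} (h : α < pheight p x) :
    ∃ y : M, α ≤ pheight p y ∧ p • y = x := by
  obtain ⟨β, rfl⟩ := WithTop.ne_top_iff_exists.1 h.ne_top
  obtain ⟨y, hy, rfl⟩ := mem_ppow_add_one.1 (coe_lt_pheight.1 h)
  exact ⟨y, coe_le_pheight.2 hy, rfl⟩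

theorem pheight_unit_mul_smul (v : Rˣ) (a : R) (x : M) :
    pheight p ((v * a : R) • x) = pheight p (a • x) := by
  rw [mul_smul, pheight_unit_smul]

theorem pheight_pow_smul_le_of_dvd {c : R} {n : ℕ} {x : M} (h : p ^ n ∣ c) :
    pheight p (p ^ n • x) ≤ pheight p (c • x) := by
  obtain ⟨d, rfl⟩ := h
  rw [mul_comm, mul_smul]
  exact pheight_le_smul _ _

theorem hull_mono {S T : Submodule R M} (h : S ≤ T) : hull S ⊆ hull T :=
  fun _ ⟨a, ha, hx⟩ => ⟨a, ha, h hx⟩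

theorem pow_smul_mem_of_le {S : Submodule R M} {x : M} {k l : ℕ} (hkl : k ≤ l)
    (h : p ^ k • x ∈ S) : p ^ l • x ∈ S := by
  obtain ⟨m, rfl⟩ := Nat.exists_eq_add_of_le' hkl
  rw [pow_add, mul_smul]
  exact S.smul_mem _ h

/-- If every element of a finite family is a multiple of an element of `S` up to a power of `p`,
then a single power of `p` works for the whole family. -/
theorem exists_uniform_pow {ι : Type*} [Finite ι] {S : Submodule R M} {x : ι → M}
    (h : ∀ i, ∃ k : ℕ, p ^ k • x i ∈ S) : ∃ k : ℕ, ∀ i, p ^ k • x i ∈ S := by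
  have := Fintype.ofFinite ι
  choose k hk using h
  exact ⟨Finset.univ.sup k, fun i =>
    pow_smul_mem_of_le (Finset.le_sup (Finset.mem_univ i)) (hk i)⟩

/-- If `S` is torsion over `T` and `x` is torsion over `S`, then `x` is torsion over `T`. -/
theorem exists_pow_smul_mem_trans {S T : Submodule R M} {s : Set M} (hS : S = Submodule.span R s)
    (h : ∀ y ∈ s, ∃ k : ℕ, p ^ k • y ∈ T) {x : M} (hx : x ∈ S) : ∃ k : ℕ, p ^ k • x ∈ T := by
  rw [hS] at hx
  induction hx using Submodule.span_induction with
  | mem y hy => exact h y hy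
  | zero => exact ⟨0, by simp⟩
  | add y z _ _ hy hz =>
    obtain ⟨k, hk⟩ := hy
    obtain ⟨l, hl⟩ := hz
    refine ⟨max k l, ?_⟩
    rw [smul_add]
    exact T.add_mem (pow_smul_mem_of_le (le_max_left _ _) hk)
      (pow_smul_mem_of_le (le_max_right _ _) hl)
  | smul a y _ hy =>
    obtain ⟨k, hk⟩ := hy
    exact ⟨k, by rw [smul_comm]; exact T.smul_mem _ hk⟩

/-- A finitely generated submodule which is torsion over `S` meets finitely many cosets of `S`. -/
theorem exists_finset_coset_reps [Finite (R ⧸ Ideal.span {p})]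
    {A S : Submodule R M} (hA : A.FG) (h : ∀ a ∈ A, ∃ k : ℕ, p ^ k • a ∈ S) :
    ∃ F : Finset M, (∀ f ∈ F, f ∈ A) ∧ ∀ a ∈ A, ∃ f ∈ F, a - f ∈ S := by
  classical
  obtain ⟨n, t, rfl⟩ := Submodule.fg_iff_exists_fin_generating_family.1 hA
  obtain ⟨k, hk⟩ := exists_uniform_pow (p := p) (S := S) (x := t)
    fun i => h _ (Submodule.subset_span ⟨i, rfl⟩)
  have hfin : Finite (R ⧸ Ideal.span {p} ^ k) :=
    Ideal.finite_quotient_pow ⟨{p}, by simp⟩ k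
  have := Fintype.ofFinite (R ⧸ Ideal.span {p} ^ k)
  let D : Finset R := Finset.univ.image (Quotient.out : R ⧸ Ideal.span {p} ^ k → R)
  have hD : ∀ c : R, ∃ d ∈ D, p ^ k ∣ c - d := fun c => by
    refine ⟨Quotient.out (Ideal.Quotient.mk (Ideal.span {p} ^ k) c),
      Finset.mem_image_of_mem _ (Finset.mem_univ _), ?_⟩
    rw [← Ideal.mem_span_singleton, ← Ideal.span_singleton_pow, ← Ideal.Quotient.eq]
    exact (Quotient.out_eq _).symm
  refine ⟨(Fintype.piFinset fun _ : Fin n => D).image fun d => ∑ i, d i • t i, ?_, ?_⟩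
  · intro f hf
    obtain ⟨d, -, rfl⟩ := Finset.mem_image.1 hf
    exact Submodule.sum_mem _ fun i _ => Submodule.smul_mem _ _ (Submodule.subset_span ⟨i, rfl⟩)
  · intro a ha
    obtain ⟨c, rfl⟩ := (Submodule.mem_span_range_iff_exists_fun R).1 ha
    choose d hdD hd using fun i => hD (c i)
    refine ⟨_, Finset.mem_image_of_mem _ (Fintype.mem_piFinset.2 hdD), ?_⟩
    rw [← Finset.sum_sub_distrib]
    refine Submodule.sum_mem _ fun i _ => ?_
    obtain ⟨e, he⟩ := hd i
    rw [← sub_smul, he, mul_comm, mul_smul]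
    exact Submodule.smul_mem _ _ (hk i)

end Height

section Valuation

variable {R : Type*} [CommRing R] [IsDomain R] [IsDiscreteValuationRing R] {p : R}
  {M : Type u} [AddCommGroup M] [Module R M]

theorem exists_eq_unit_mul_pow (hp : Irreducible p) {c : R} (hc : c ≠ 0) :
    ∃ (v : Rˣ) (n : ℕ), c = v * p ^ n := by
  obtain ⟨n, v, hv⟩ := IsDiscreteValuationRing.associated_pow_irreducible hc hp
  exact ⟨v⁻¹, n, by rw [← hv, mul_comm, mul_assoc, Units.mul_inv, mul_one]⟩

theorem pow_dvd_of_pheight_lt (hp : Irreducible p) {c : R} {n : ℕ} {x : M}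
    (h : pheight p (p ^ n • x) < pheight p (c • x)) : p ^ (n + 1) ∣ c := by
  rcases eq_or_ne c 0 with rfl | hc
  · exact dvd_zero _
  obtain ⟨v, m, rfl⟩ := exists_eq_unit_mul_pow hp hc
  rw [pheight_unit_mul_smul] at h
  have hnm : n < m := by
    by_contra! hmn
    exact absurd h (not_lt.2 (pheight_pow_smul_mono hmn))
  exact (pow_dvd_pow p hnm).mul_left _

theorem mem_hull_iff (hp : Irreducible p) {S : Submodule R M} {x : M} :
    x ∈ hull S ↔ ∃ k : ℕ, p ^ k • x ∈ S := by
  refine ⟨?_, fun ⟨k, h⟩ => ⟨p ^ k, pow_ne_zero k hp.ne_zero, h⟩⟩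
  rintro ⟨a, ha, h⟩
  obtain ⟨v, n, rfl⟩ := exists_eq_unit_mul_pow hp ha
  refine ⟨n, ?_⟩
  have := S.smul_mem (↑v⁻¹ : R) h
  rwa [mul_smul, smul_smul, Units.inv_mul, one_smul] at this

end Valuation

section Decomposition

variable {R : Type*} [CommRing R] {p : R} {M : Type u} [AddCommGroup M] [Module R M]

/-- A finite family which is linearly independent and for which the height of a linear combination
is the minimum of the heights of its terms. -/
structure IsDecompFamily (p : R) {ι : Type*} [Fintype ι] (x : ι → M) : Prop where
  height_le : ∀ (c : ι → R) (j : ι), pheight p (∑ i, c i • x i) ≤ pheight p (c j • x j)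
  indep : ∀ c : ι → R, ∑ i, c i • x i = 0 → ∀ j, c j = 0

theorem IsDecompWrt.isDecompFamily {X : Set M} (hX : IsDecompWrt p X) {ι : Type*} [Fintype ι]
    {x : ι → M} (hx : Function.Injective x) (hmem : ∀ i, x i ∈ X) : IsDecompFamily p x where
  height_le c j := by
    classical
    obtain ⟨c', hc'⟩ : ∃ c' : M → R, ∀ i, c' (x i) = c i :=
      ⟨Function.extend x c 0, fun i => hx.extend_apply c 0 i⟩
    have h := hX.2.2 (Finset.univ.map ⟨x, hx⟩) (by simpa [Set.range_subset_iff] using hmem) c'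
    simp only [Finset.sum_map, Function.Embedding.coeFn_mk, hc'] at h
    rw [h, ← hc' j]
    exact Finset.inf_le (f := fun y => pheight p (c' y • y))
      (Finset.mem_map_of_mem ⟨x, hx⟩ (Finset.mem_univ j))
  indep := by
    have : LinearIndependent R x :=
      hX.1.comp (fun i => (⟨x i, hmem i⟩ : X)) fun i j h => hx (congrArg Subtype.val h)
    exact Fintype.linearIndependent_iff.1 this

variable {ι : Type*} [Fintype ι] {x : ι → M}

theorem IsDecompFamily.pow_smul [IsDomain R] (hx : IsDecompFamily p x) (hp : p ≠ 0) (n : ι → ℕ) :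
    IsDecompFamily p fun i => p ^ n i • x i := by
  refine ⟨fun c j => ?_, fun c h j => ?_⟩
  · simp only [smul_smul]
    exact hx.height_le (fun i => c i * p ^ n i) j
  · simp only [smul_smul] at h
    exact (mul_eq_zero.1 (hx.indep (fun i => c i * p ^ n i) h j)).resolve_right
      (pow_ne_zero _ hp)

variable [IsDomain R] [IsDiscreteValuationRing R]

/-- The span of a decomposition family is nice in its hull. -/
theorem IsDecompFamily.exists_max_pheight (hx : IsDecompFamily p x) (hp : Irreducible p) {g : M}
    {k : ℕ} (hg : p ^ k • g ∈ Submodule.span R (Set.range x)) :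
    ∃ a ∈ Submodule.span R (Set.range x), ∀ a' ∈ Submodule.span R (Set.range x),
      pheight p (g + a') ≤ pheight p (g + a) := by
  obtain ⟨b, hb⟩ := (Submodule.mem_span_range_iff_exists_fun R).1 hg
  let γ : (ι → R) → WithTop Ordinal.{u} := fun c => pheight p (g + ∑ i, c i • x i)
  have hsub : ∀ (c c' : ι → R) (j : ι) (δ : WithTop Ordinal.{u}), δ ≤ γ c → δ ≤ γ c' →
      δ ≤ pheight p ((c j - c' j) • x j) := fun c c' j δ h h' => by
    refine le_trans ?_ (hx.height_le (fun i => c i - c' i) j)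
    have := le_pheight_sub h h'
    simpa [sub_smul, Finset.sum_sub_distrib] using this
  have hmul : ∀ (c : ι → R) (j : ι), γ c ≤ pheight p ((b j + p ^ k * c j) • x j) := fun c j => by
    refine le_trans ?_ (hx.height_le (fun i => b i + p ^ k * c i) j)
    refine (pheight_le_smul (p ^ k) _).trans_eq ?_
    simp only [smul_add, ← hb, add_smul, Finset.sum_add_distrib, Finset.smul_sum, mul_smul]
  suffices h : ∀ j, ∃ d : R, ∀ c : ι → R, γ c ≤ pheight p ((d - c j) • x j) by
    choose d hd using h
    refine ⟨_, (Submodule.mem_span_range_iff_exists_fun R).2 ⟨d, rfl⟩, fun a' ha' => ?_⟩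
    obtain ⟨c, rfl⟩ := (Submodule.mem_span_range_iff_exists_fun R).1 ha'
    have h₁ : γ c ≤ pheight p (∑ i, (d i - c i) • x i) := le_pheight_sum fun i _ => hd i c
    have h₂ := le_pheight_add (le_refl (γ c)) h₁
    simpa [sub_smul, Finset.sum_sub_distrib] using h₂
  intro j
  by_cases hN : ∃ N : ℕ, ∀ c, γ c ≤ pheight p (p ^ N • x j)
  · classical
    rcases h : Nat.find hN with _ | N
    · have h0 := Nat.find_spec hN
      simp only [h, pow_zero, one_smul] at h0
      exact ⟨0, fun c => (h0 c).trans (pheight_le_smul _ _)⟩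
    · have hle := Nat.find_spec hN
      have hlt := Nat.find_min hN (m := N) (by omega)
      rw [h] at hle
      push Not at hlt
      obtain ⟨c₀, hc₀⟩ := hlt
      refine ⟨c₀ j, fun c => ?_⟩
      rcases le_or_gt (γ c) (γ c₀) with h' | h'
      · exact hsub _ _ _ _ h' le_rfl
      · exact (hle c).trans (pheight_pow_smul_le_of_dvd
          (pow_dvd_of_pheight_lt hp (hc₀.trans_le (hsub _ _ _ _ le_rfl h'.le))))
  · push Not at hN
    obtain ⟨b', hb'⟩ : p ^ k ∣ b j := by
      obtain ⟨c, hc⟩ := hN k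
      have := (pow_dvd_pow p (Nat.le_succ k)).trans
        (pow_dvd_of_pheight_lt hp (hc.trans_le (hmul c j)))
      exact (dvd_add_left (dvd_mul_right _ _)).1 this
    refine ⟨-b', fun c => ?_⟩
    rw [show -b' - c j = -(b' + c j) by ring, neg_smul, pheight_neg]
    rcases eq_or_ne (b' + c j) 0 with h0 | h0
    · simp [h0]
    obtain ⟨v, m, hv⟩ := exists_eq_unit_mul_pow hp h0
    obtain ⟨c', hcc', hc'⟩ : ∃ c', γ c ≤ γ c' ∧ pheight p (p ^ (k + m) • x j) < γ c' := by
      obtain ⟨c', hc'⟩ := hN (k + m)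
      rcases le_total (γ c) (γ c') with h | h
      · exact ⟨c', h, hc'⟩
      · exact ⟨c, le_rfl, hc'.trans_le h⟩
    have hdvd := pow_dvd_of_pheight_lt hp (hc'.trans_le (hmul c' j))
    rw [hb', ← mul_add, add_assoc, pow_add, mul_dvd_mul_iff_left (pow_ne_zero k hp.ne_zero)] at hdvd
    rw [hv, pheight_unit_mul_smul]
    refine (hsub c c' j _ le_rfl hcc').trans (not_lt.1 fun hlt => ?_)
    have h₁ := dvd_add (pow_dvd_of_pheight_lt hp hlt) hdvd
    rw [show c j - c' j + (b' + c' j) = b' + c j by ring, hv, Units.dvd_mul_left] at h₁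
    exact absurd ((pow_dvd_pow_iff hp.ne_zero hp.not_isUnit).1 h₁) (by omega)

variable [Finite (R ⧸ Ideal.span {p})]

/-- A finitely generated submodule commensurable with the span of a decomposition family is nice
in its hull. -/
theorem IsDecompFamily.exists_max_pheight_of_fg (hx : IsDecompFamily p x) (hp : Irreducible p)
    {A : Submodule R M} (hA : A.FG) (hxA : ∀ i, ∃ n : ℕ, p ^ n • x i ∈ A)
    (hAx : ∀ a ∈ A, ∃ k : ℕ, p ^ k • a ∈ Submodule.span R (Set.range x)) {g : M} {k : ℕ}
    (hg : p ^ k • g ∈ A) : ∃ a ∈ A, ∀ a' ∈ A, pheight p (g + a') ≤ pheight p (g + a) := by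
  choose n hn using hxA
  have hx' := hx.pow_smul hp.ne_zero n
  set S := Submodule.span R (Set.range fun i => p ^ n i • x i) with hS
  have hSA : S ≤ A := Submodule.span_le.2 (Set.range_subset_iff.2 hn)
  have hAS : ∀ a ∈ A, ∃ k : ℕ, p ^ k • a ∈ S := fun a ha => by
    obtain ⟨k, hk⟩ := hAx a ha
    obtain ⟨l, hl⟩ := exists_pow_smul_mem_trans (p := p) (T := S) rfl
      (by rintro _ ⟨i, rfl⟩; exact ⟨n i, Submodule.subset_span ⟨i, rfl⟩⟩) hk
    exact ⟨l + k, by rwa [pow_add, mul_smul]⟩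
  obtain ⟨F, hFA, hF⟩ := exists_finset_coset_reps hA hAS
  have hmax : ∀ f ∈ F, ∃ s ∈ S, ∀ s' ∈ S, pheight p (g + f + s') ≤ pheight p (g + f + s) := by
    intro f hf
    obtain ⟨l, hl⟩ := hAS (p ^ k • (g + f))
      (by rw [smul_add]; exact A.add_mem hg (A.smul_mem _ (hFA f hf)))
    rw [smul_smul, ← pow_add] at hl
    exact hx'.exists_max_pheight hp hl
  choose! s hsS hs using hmax
  obtain ⟨f₀, hf₀, -⟩ := hF 0 A.zero_mem
  obtain ⟨f, hf, hfmax⟩ := F.exists_max_image (fun f => pheight p (g + f + s f)) ⟨f₀, hf₀⟩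
  refine ⟨f + s f, A.add_mem (hFA f hf) (hSA (hsS f hf)), fun a ha => ?_⟩
  obtain ⟨f', hf', haf⟩ := hF a ha
  have h := (hs f' hf' _ haf).trans (hfmax f' hf')
  rwa [show g + f' + (a - f') = g + a by abel, add_assoc g f] at h

/-- Sufficiently high multiples of an element completing a decomposition family are in valuated
direct sum with a given finitely generated submodule of the hull of the family. -/
theorem IsDecompFamily.exists_forall_pheight_add_le (hx : IsDecompFamily p x) (hp : Irreducible p)
    {A : Submodule R M} (hA : A.FG)
    (hAx : ∀ a ∈ A, ∃ k : ℕ, p ^ k • a ∈ Submodule.span R (Set.range x)) {z : M}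
    (hz : ∀ s ∈ Submodule.span R (Set.range x), ∀ d : R,
      pheight p (s + d • z) ≤ pheight p (d • z)) :
    ∃ N : ℕ, ∀ n ≥ N, ∀ a ∈ A, ∀ d : R,
      pheight p (a + d • p ^ n • z) ≤ pheight p (d • p ^ n • z) := by
  obtain ⟨F, hFA, hF⟩ := exists_finset_coset_reps hA hAx
  have hmax : ∀ f ∈ F, ∃ s ∈ Submodule.span R (Set.range x),
      ∀ s' ∈ Submodule.span R (Set.range x), pheight p (f + s') ≤ pheight p (f + s) :=
    fun f hf => hx.exists_max_pheight hp (hAx f (hFA f hf)).choose_spec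
  choose! s hsS hs using hmax
  have hN : ∀ f : F, ∃ N : ℕ, ∀ n ≥ N, pheight p (p ^ n • z) ≠ ⊤ →
      pheight p (p ^ n • z) ≠ pheight p (f + s f) := by
    intro f
    by_cases h : ∃ m, pheight p (p ^ m • z) = pheight p (f + s f)
    · obtain ⟨m, hm⟩ := h
      refine ⟨m + 1, fun n hn htop heq => ?_⟩
      rw [← hm] at heq
      exact (pheight_pow_smul_lt (p := p) (x := z) hn (heq ▸ htop)).ne heq.symm
    · push Not at h
      exact ⟨0, fun n _ _ => h n⟩
  choose N hN using hN
  refine ⟨Finset.univ.sup N, fun n hn a ha d => not_lt.1 fun hlt => ?_⟩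
  have hd : d ≠ 0 := by
    rintro rfl
    simp at hlt
  obtain ⟨v, j, rfl⟩ := exists_eq_unit_mul_pow hp hd
  obtain ⟨f, hf, haf⟩ := hF a ha
  have hne : pheight p ((v * p ^ j : R) • p ^ n • z) ≠ pheight p (f + s f) := by
    have htop := hlt.ne_top
    rw [pheight_unit_mul_smul, smul_smul, ← pow_add] at htop ⊢
    exact hN ⟨f, hf⟩ (j + n)
      (((Finset.le_sup (Finset.mem_univ _)).trans hn).trans (Nat.le_add_left _ _)) htop
  set w := (v * p ^ j : R) • p ^ n • z with hw
  have h₁ : pheight p a = pheight p w := pheight_eq_of_lt_add hlt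
  have h₂ : pheight p (a - f - s f + w) ≤ pheight p w := by
    rw [hw, smul_smul]
    exact hz _ (Submodule.sub_mem _ haf (hsS f hf)) _
  have h₃ : pheight p (f + s f) = pheight p (a - f - s f + w) := by
    refine pheight_eq_of_lt_add ?_
    rw [show f + s f + (a - f - s f + w) = a + w by abel]
    exact h₂.trans_lt hlt
  have h₄ : pheight p a ≤ pheight p (f + s f) := by
    have := hs f hf _ haf
    rwa [add_sub_cancel] at this
  exact hne (le_antisymm (h₁.symm.le.trans h₄) (h₃.trans_le h₂))

end Decomposition

section UlmInvariants

variable {R : Type*} [CommRing R] {p : R} {M : Type u} [AddCommGroup M] [Module R M]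

/-- The family `u` is linearly independent modulo `D` over the residue ring `R/(p)`. -/
def IndepMod (p : R) (D : Submodule R M) {ι : Type*} [Fintype ι] (u : ι → M) : Prop :=
  ∀ c : ι → R, ∑ i, c i • u i ∈ D → ∀ i, p ∣ c i

theorem natCast_le_rank_quotient_iff (hp : ¬ IsUnit p) {Q : Type u} [AddCommGroup Q] [Module R Q]
    (hQ : ∀ x : Q, p • x = 0) (n : ℕ) :
    (n : Cardinal) ≤ Module.rank (R ⧸ Ideal.span {p})
      (Q ⧸ (Ideal.span {p} • (⊤ : Submodule R Q))) ↔
      ∃ u : Fin n → Q, IndepMod p ⊥ u := by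
  have hnt : Nontrivial (R ⧸ Ideal.span {p}) :=
    Ideal.Quotient.nontrivial_iff.2 (by rwa [Ne, Ideal.span_singleton_eq_top])
  have hbot : Ideal.span {p} • (⊤ : Submodule R Q) = ⊥ := by
    rw [eq_bot_iff, Submodule.ideal_span_singleton_smul]
    rintro _ ⟨x, -, rfl⟩
    exact hQ x
  have key : ∀ (c : Fin n → R) (u : Fin n → Q),
      ∑ i, Ideal.Quotient.mk (Ideal.span {p}) (c i) •
        Submodule.Quotient.mk (p := Ideal.span {p} • (⊤ : Submodule R Q)) (u i) = 0 ↔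
      ∑ i, c i • u i ∈ (⊥ : Submodule R Q) := fun c u => by
    have : ∑ i, Ideal.Quotient.mk (Ideal.span {p}) (c i) •
        Submodule.Quotient.mk (p := Ideal.span {p} • (⊤ : Submodule R Q)) (u i) =
        (Ideal.span {p} • (⊤ : Submodule R Q)).mkQ (∑ i, c i • u i) := by
      rw [map_sum]
      rfl
    rw [this, ← LinearMap.mem_ker, Submodule.ker_mkQ, hbot]
  rw [Module.le_rank_iff]
  constructor
  · rintro ⟨v, hv⟩
    choose u hu using fun i => Submodule.Quotient.mk_surjective _ (v i)
    refine ⟨u, fun c hc i => ?_⟩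
    rw [← key] at hc
    simp_rw [hu] at hc
    have := Fintype.linearIndependent_iff.1 hv _ hc i
    rwa [Ideal.Quotient.eq_zero_iff_mem, Ideal.mem_span_singleton] at this
  · rintro ⟨u, hu⟩
    refine ⟨fun i => Submodule.Quotient.mk (u i), Fintype.linearIndependent_iff.2 fun g hg i => ?_⟩
    choose c hc using fun i => Ideal.Quotient.mk_surjective (g i)
    simp_rw [← hc] at hg
    rw [← hc, Ideal.Quotient.eq_zero_iff_mem, Ideal.mem_span_singleton]
    exact hu c ((key c u).1 hg) i

theorem natCast_le_uHat_iff (hp : ¬ IsUnit p) (α : Ordinal.{u}) (n : ℕ) :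
    (n : Cardinal) ≤ uHat p M α ↔ ∃ u : Fin n → M,
      (∀ i, u i ∈ ppow p α ∧ p • u i = 0) ∧ IndepMod p (ppow p (α + 1)) u := by
  rw [uHat, le_min_iff, and_iff_left (Cardinal.natCast_le_aleph0)]
  unfold uCard
  rw [natCast_le_rank_quotient_iff hp]
  · constructor
    · rintro ⟨v, hv⟩
      choose u hu using fun i => Submodule.Quotient.mk_surjective _ (v i)
      refine ⟨fun i => u i, fun i => (u i).2, fun c hc => hv c ?_⟩
      simp_rw [← hu]
      have hmem : ∑ i, c i • u i ∈ (ppow p (α + 1) ⊓ Submodule.torsionBy R M p).comap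
          (ppow p α ⊓ Submodule.torsionBy R M p).subtype := by
        refine ⟨by simpa using hc, (∑ i, c i • u i).2.2⟩
      rw [Submodule.mem_bot, ← (Submodule.Quotient.mk_eq_zero _).2 hmem]
      simp only [← Submodule.mkQ_apply, map_sum, map_smul]
    · rintro ⟨u, hu, hi⟩
      let w : Fin n → ↥(ppow p α ⊓ Submodule.torsionBy R M p) := fun i => ⟨u i, hu i⟩
      refine ⟨fun i => Submodule.Quotient.mk (w i), fun c hc => hi c ?_⟩
      simp only [Submodule.mem_bot, ← Submodule.mkQ_apply, ← map_smul, ← map_sum] at hc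
      rw [← LinearMap.mem_ker, Submodule.ker_mkQ] at hc
      simpa [w] using hc.1
  · intro x
    obtain ⟨v, rfl⟩ := Submodule.Quotient.mk_surjective _ x
    rw [← Submodule.Quotient.mk_smul, show p • v = 0 from Subtype.ext v.2.2]
    rfl

theorem natCast_le_uHatInf_iff (hp : ¬ IsUnit p) (n : ℕ) :
    (n : Cardinal) ≤ uHatInf p M ↔ ∃ u : Fin n → M,
      (∀ i, pheight p (u i) = ⊤ ∧ p • u i = 0) ∧ IndepMod p ⊥ u := by
  unfold uHatInf
  rw [le_min_iff, and_iff_left (Cardinal.natCast_le_aleph0),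
    natCast_le_rank_quotient_iff hp fun x => Subtype.ext x.2.2]
  constructor
  · rintro ⟨v, hv⟩
    refine ⟨fun i => v i, fun i => ⟨?_, (v i).2.2⟩, fun c hc => hv c ?_⟩
    · exact pheight_eq_top.2 fun α => (Submodule.mem_iInf _).1 (v i).2.1 α
    · rw [Submodule.mem_bot] at hc ⊢
      exact Subtype.ext (by simpa using hc)
  · rintro ⟨u, hu, hi⟩
    refine ⟨fun i => ⟨u i, (Submodule.mem_iInf _).2 (pheight_eq_top.1 (hu i).1), (hu i).2⟩,
      fun c hc => hi c ?_⟩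
    rw [Submodule.mem_bot] at hc ⊢
    simpa using congrArg Subtype.val hc

theorem eq_of_forall_natCast_le_iff {a b : Cardinal.{u}} (ha : a ≤ Cardinal.aleph0)
    (hb : b ≤ Cardinal.aleph0) (h : ∀ n : ℕ, (n : Cardinal) ≤ a ↔ (n : Cardinal) ≤ b) : a = b := by
  have key : ∀ {a b : Cardinal.{u}}, a ≤ Cardinal.aleph0 →
      (∀ n : ℕ, (n : Cardinal) ≤ a → (n : Cardinal) ≤ b) → a ≤ b := by
    intro a b ha h
    rcases ha.lt_or_eq with ha | rfl
    · obtain ⟨n, rfl⟩ := Cardinal.lt_aleph0.1 ha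
      exact h n le_rfl
    · exact Cardinal.aleph0_le.2 fun n => h n Cardinal.natCast_le_aleph0
  exact le_antisymm (key ha fun n => (h n).1) (key hb fun n => (h n).2)

/-- Inside a finitely generated module, the length of families independent modulo `D` and
annihilated by `p` modulo `D` is bounded. -/
theorem exists_bound_indepMod [IsNoetherianRing R] (hp : ¬ IsUnit p) {A : Submodule R M}
    (hA : A.FG) (D : Submodule R M) :
    ∃ N : ℕ, ∀ (n : ℕ) (u : Fin n → M), (∀ i, u i ∈ A ∧ p • u i ∈ D) → IndepMod p D u →
      n ≤ N := by
  have hnt : Nontrivial (R ⧸ Ideal.span {p}) :=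
    Ideal.Quotient.nontrivial_iff.2 (by rwa [Ne, Ideal.span_singleton_eq_top])
  have : IsNoetherian R A := isNoetherian_of_fg_of_noetherian A hA
  have hV : (A ⊓ D.comap (LinearMap.lsmul R M p)).FG := Submodule.FG.of_le hA inf_le_left
  obtain ⟨m, t, ht⟩ := Submodule.fg_iff_exists_fin_generating_family.1 hV
  refine ⟨m, fun n u hu hi => ?_⟩
  have htD : ∀ j, p • t j ∈ D := fun j => by
    have : t j ∈ A ⊓ D.comap (LinearMap.lsmul R M p) := ht ▸ Submodule.subset_span ⟨j, rfl⟩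
    exact this.2
  have hspan : ∀ i, ∃ e : Fin m → R, ∑ j, e j • t j = u i := fun i =>
    (Submodule.mem_span_range_iff_exists_fun R).1 (ht ▸ (⟨(hu i).1, (hu i).2⟩ :
      u i ∈ A ⊓ D.comap (LinearMap.lsmul R M p)))
  choose e he using hspan
  let E : Matrix (Fin n) (Fin m) (R ⧸ Ideal.span {p}) :=
    Matrix.of fun i j => Ideal.Quotient.mk _ (e i j)
  have hinj : Function.Injective E.vecMulLinear := by
    rw [injective_iff_map_eq_zero]
    intro g hg
    choose c hc using fun i => Ideal.Quotient.mk_surjective (g i)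
    have hdvd : ∀ j, p ∣ ∑ i, c i * e i j := fun j => by
      rw [← Ideal.mem_span_singleton, ← Ideal.Quotient.eq_zero_iff_mem, map_sum]
      have := congrFun hg j
      simpa [E, Matrix.vecMul, dotProduct, ← hc] using this
    choose d hd using hdvd
    ext i
    rw [← hc, Pi.zero_apply, Ideal.Quotient.eq_zero_iff_mem, Ideal.mem_span_singleton]
    refine hi c ?_ i
    have : ∑ i, c i • u i = ∑ j, d j • p • t j := by
      simp_rw [← he, Finset.smul_sum, smul_smul]
      rw [Finset.sum_comm]
      simp_rw [← Finset.sum_smul, hd, mul_comm]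
    rw [this]
    exact D.sum_mem fun j _ => D.smul_mem _ (htD j)
  simpa using card_le_of_injective _ E.vecMulLinear hinj

end UlmInvariants

section UlmClasses

theorem UlmEquiv.symm {a b : ℕ → WithTop Ordinal.{u}} (h : UlmEquiv a b) : UlmEquiv b a := by
  obtain ⟨m, n, h⟩ := h
  exact ⟨n, m, fun i => (h i).symm⟩

theorem UlmEquiv.trans {a b c : ℕ → WithTop Ordinal.{u}} (h : UlmEquiv a b) (h' : UlmEquiv b c) :
    UlmEquiv a c := by
  obtain ⟨m, n, h⟩ := h
  obtain ⟨m', n', h'⟩ := h'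
  refine ⟨m + m', n + n', fun i => ?_⟩
  rw [show i + (n + n') = i + n' + n by ring, h, show i + n' + m = i + m + n' by ring, h',
    add_assoc]

theorem UlmEquiv.refl (a : ℕ → WithTop Ordinal.{u}) : UlmEquiv a a := ⟨0, 0, fun _ => rfl⟩

variable {R : Type*} [CommRing R] {p : R} {M : Type u} [AddCommGroup M] [Module R M]

theorem HasAtLeast.mono {e : ℕ → WithTop Ordinal.{u}} {n : ℕ} {X Y : Set M}
    (h : HasAtLeast p e n X) (hXY : X ⊆ Y) : HasAtLeast p e n Y := by
  obtain ⟨s, hs, h⟩ := h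
  exact ⟨s, hs.trans hXY, h⟩

theorem exists_hasAtLeast_of_le_wHat {C : Set (Set M)} (hC : C.Nonempty)
    {e : ℕ → WithTop Ordinal.{u}} {n : ℕ} (h : (n : ℕ∞) ≤ wHat p C e) :
    ∃ X ∈ C, HasAtLeast p e n X := by
  rcases n with _ | n
  · obtain ⟨X, hX⟩ := hC
    exact ⟨X, hX, ∅, by simp⟩
  · have hlt : (n : ℕ∞) < wHat p C e :=
      lt_of_lt_of_le (by exact_mod_cast Nat.lt_succ_self n) h
    obtain ⟨_, ⟨m, rfl, X, hX, s, hs, hcard, hse⟩, hm⟩ := lt_sSup_iff.1 hlt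
    have hm' : n < m := by exact_mod_cast hm
    exact ⟨X, hX, s, hs, by omega, hse⟩

theorem le_wHat {C : Set (Set M)} {e : ℕ → WithTop Ordinal.{u}} {n : ℕ} {X : Set M} (hX : X ∈ C)
    (h : HasAtLeast p e n X) : (n : ℕ∞) ≤ wHat p C e :=
  le_sSup ⟨n, rfl, X, hX, h⟩

variable [IsDomain R] [IsDiscreteValuationRing R]

open scoped Classical in
/-- Warfield's invariants do not decrease: if a part of a decomposition family `x` consisting of
elements of class `e` lies in the hull of a decomposition family `y`, which in turn lies in the
hull of `x`, then `y` has at least as many members of class `e`. -/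
theorem IsDecompFamily.card_le (hp : Irreducible p) {ι κ σ : Type*} [Fintype ι] [Fintype κ]
    [Fintype σ] {x : ι → M} {y : κ → M} (hx : IsDecompFamily p x) (hy : IsDecompFamily p y)
    {f : σ → ι} (hf : Function.Injective f) {e : ℕ → WithTop Ordinal.{u}}
    (he : ∀ s, UlmEquiv (UlmSeqOf p (x (f s))) e)
    (hxy : ∀ s, ∃ k : ℕ, p ^ k • x (f s) ∈ Submodule.span R (Set.range y))
    (hyx : ∀ j, ∃ k : ℕ, p ^ k • y j ∈ Submodule.span R (Set.range x)) :
    Fintype.card σ ≤ Fintype.card {j // UlmEquiv (UlmSeqOf p (y j)) e} := by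
  choose m n hmn using he
  let B := Finset.univ.sup m
  have hmB : ∀ s, m s ≤ B := fun s => Finset.le_sup (Finset.mem_univ s)
  let a : ι → ℕ := Function.extend f (fun s => n s + (B - m s)) 0
  have hu : ∀ s i, pheight p (p ^ i • p ^ a (f s) • x (f s)) = e (i + B) := fun s i => by
    have h := hmn s (i + (B - m s))
    rw [show i + (B - m s) + m s = i + B by have := hmB s; omega] at h
    rw [← h, UlmSeqOf, smul_smul, ← pow_add]
    congr 3
    simp only [a, hf.extend_apply]
    omega
  have hx' := hx.pow_smul hp.ne_zero a
  obtain ⟨K, hK⟩ : ∃ K : ℕ, ∀ s, p ^ K • p ^ a (f s) • x (f s) ∈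
      Submodule.span R (Set.range y) := exists_uniform_pow fun s => by
    obtain ⟨k, hk⟩ := hxy s
    exact ⟨k, by rw [smul_comm]; exact Submodule.smul_mem _ _ hk⟩
  obtain ⟨L, hL⟩ : ∃ L : ℕ, ∀ j, p ^ L • y j ∈
      Submodule.span R (Set.range fun i => p ^ a i • x i) := exists_uniform_pow fun j => by
    obtain ⟨k, hk⟩ := hyx j
    obtain ⟨l, hl⟩ := exists_pow_smul_mem_trans (p := p)
      (T := Submodule.span R (Set.range fun i => p ^ a i • x i)) rfl
      (by rintro _ ⟨i, rfl⟩; exact ⟨a i, Submodule.subset_span ⟨i, rfl⟩⟩) hk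
    exact ⟨l + k, by rwa [pow_add, mul_smul]⟩
  choose c hc using fun s => (Submodule.mem_span_range_iff_exists_fun R).1 (hK s)
  choose d hd using fun j => (Submodule.mem_span_range_iff_exists_fun R).1 (hL j)
  have hcd : ∀ s i, ∑ j, c s j * d j i = if i = f s then p ^ (K + L) else 0 := fun s i => by
    have hsum : ∑ i, (∑ j, c s j * d j i - if i = f s then p ^ (K + L) else 0) •
        p ^ a i • x i = 0 := by
      have h₁ : ∑ i, (∑ j, c s j * d j i) • p ^ a i • x i = ∑ j, c s j • p ^ L • y j := by
        simp_rw [← hd, Finset.smul_sum, Finset.sum_smul, mul_smul]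
        exact Finset.sum_comm
      have h₂ : ∑ j, c s j • p ^ L • y j = p ^ L • p ^ K • p ^ a (f s) • x (f s) := by
        rw [← hc, Finset.smul_sum]
        exact Finset.sum_congr rfl fun j _ => smul_comm _ _ _
      simp only [sub_smul, Finset.sum_sub_distrib, h₁, h₂, ite_smul, zero_smul,
        Finset.sum_ite_eq', Finset.mem_univ, if_true]
      rw [smul_smul (p ^ L) (p ^ K), ← pow_add, add_comm L K, sub_self]
    exact sub_eq_zero.1 (hx'.indep _ hsum i)
  have hdvd : ∀ s s' j, ¬ UlmEquiv (UlmSeqOf p (y j)) e →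
      p ^ (K + L) * p ∣ c s j * d j (f s') := fun s s' j hj => by
    rcases eq_or_ne (c s j) 0 with h0 | h0
    · simp [h0]
    obtain ⟨v, r, hv⟩ := exists_eq_unit_mul_pow hp h0
    have hle : ∀ i, e (i + K + B) ≤ pheight p (p ^ i • c s j • y j) := fun i => by
      rw [← hu s, pow_add, mul_smul, ← hc, Finset.smul_sum, smul_smul]
      simp_rw [smul_smul]
      exact hy.height_le (fun j => p ^ i * c s j) j
    obtain ⟨i, hi⟩ : ∃ i, e (i + L + K + B) < pheight p (p ^ (i + L) • c s j • y j) := by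
      by_contra! hcon
      refine hj ⟨L + K + B, r + L, fun i => ?_⟩
      have h := le_antisymm (hcon i) (hle (i + L))
      rw [hv, smul_comm, pheight_unit_mul_smul, smul_smul, ← pow_add] at h
      rw [UlmSeqOf, show i + (r + L) = r + (i + L) by ring, h,
        show i + (L + K + B) = i + L + K + B by ring]
    have h₁ : pheight p (p ^ (i + L) • c s j • y j) ≤
        pheight p ((p ^ i * c s j * d j (f s')) • p ^ a (f s') • x (f s')) := by
      have := hx'.height_le (fun l => p ^ i * c s j * d j l) (f s')
      refine le_trans (le_of_eq ?_) this
      simp_rw [mul_smul (p ^ i * c s j), ← Finset.smul_sum]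
      rw [hd, smul_smul, smul_smul]
      congr 2
      ring
    rw [show i + L + K + B = (i + L + K) + B by ring, ← hu s'] at hi
    have h₂ := pow_dvd_of_pheight_lt hp (hi.trans_le h₁)
    rw [show p ^ (i + L + K + 1) = p ^ i * (p ^ (K + L) * p) by ring, mul_assoc,
      mul_dvd_mul_iff_left (pow_ne_zero _ hp.ne_zero)] at h₂
    exact h₂
  have hq : ∀ s s', ∃ q : R, ∑ j : {j // ¬ UlmEquiv (UlmSeqOf p (y j)) e},
      c s j * d j (f s') = p ^ (K + L) * p * q := fun s s' =>
    Finset.dvd_sum fun j _ => hdvd s s' j j.2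
  choose q hq using hq
  let c' : Matrix σ {j // UlmEquiv (UlmSeqOf p (y j)) e} R := Matrix.of fun s j => c s j
  let d' : Matrix {j // UlmEquiv (UlmSeqOf p (y j)) e} σ R := Matrix.of fun j s => d j (f s)
  let q' : Matrix σ σ R := Matrix.of q
  have hmat : c' * d' = p ^ (K + L) • (1 - p • q') := by
    ext s s'
    have h := hcd s (f s')
    rw [← Fintype.sum_subtype_add_sum_subtype (fun j => UlmEquiv (UlmSeqOf p (y j)) e), hq,
      ← eq_sub_iff_add_eq] at h
    simp only [c', d', q', Matrix.mul_apply, Matrix.of_apply, Matrix.smul_apply, Matrix.sub_apply,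
      Matrix.one_apply, smul_eq_mul, h, hf.eq_iff, eq_comm (a := s')]
    split_ifs <;> ring
  have hdet : (c' * d').det ≠ 0 := by
    rw [hmat, Matrix.det_smul]
    refine mul_ne_zero (pow_ne_zero _ (pow_ne_zero _ hp.ne_zero)) fun h0 => ?_
    have hnt : Nontrivial (R ⧸ Ideal.span {p}) := Ideal.Quotient.nontrivial_iff.2
      (by rw [Ne, Ideal.span_singleton_eq_top]; exact hp.not_isUnit)
    have h := congrArg (Ideal.Quotient.mk (Ideal.span {p})) h0
    have hone : (1 - p • q').map (Ideal.Quotient.mk (Ideal.span {p})) = 1 := by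
      ext s s'
      have hp0 : Ideal.Quotient.mk (Ideal.span {p}) p = 0 :=
        Ideal.Quotient.eq_zero_iff_mem.2 (Ideal.mem_span_singleton_self p)
      simp [Matrix.one_apply, hp0, apply_ite]
    rw [RingHom.map_det, RingHom.mapMatrix_apply, hone, Matrix.det_one, map_zero] at h
    exact one_ne_zero h
  refine card_le_of_injective R c'.vecMulLinear ?_
  rw [injective_iff_map_eq_zero]
  intro v hv
  refine Matrix.eq_zero_of_vecMul_eq_zero hdet ?_
  rw [← Matrix.vecMul_vecMul, show Matrix.vecMul v c' = 0 from hv, Matrix.zero_vecMul]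

end UlmClasses

section Graphs

variable {R : Type*} [CommRing R] {p : R} {M N : Type u} [AddCommGroup M] [Module R M]
  [AddCommGroup N] [Module R N]

/-- The converse of a linear relation. -/
def converse (Γ : Submodule R (M × N)) : Submodule R (N × M) :=
  Γ.comap (LinearEquiv.prodComm R N M).toLinearMap

theorem sum_smul_mem {Γ : Submodule R (M × N)} {ι : Type*} [Fintype ι] {x : ι → M} {y : ι → N}
    (h : ∀ i, (x i, y i) ∈ Γ) (c : ι → R) : (∑ i, c i • x i, ∑ i, c i • y i) ∈ Γ := by
  have : (∑ i, c i • x i, ∑ i, c i • y i) = ∑ i, c i • (x i, y i) := by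
    ext <;> simp [Prod.fst_sum, Prod.snd_sum]
  rw [this]
  exact Γ.sum_mem fun i _ => Γ.smul_mem _ (h i)

/-- A system of graphs of isomorphisms between submodules of `M` and `N` with the back-and-forth
property. -/
structure IsGraphSystem (𝒢 : Set (Submodule R (M × N))) : Prop where
  nonempty : 𝒢.Nonempty
  fst_eq_zero_iff : ∀ Γ ∈ 𝒢, ∀ γ ∈ Γ, γ.1 = 0 ↔ γ.2 = 0
  forth : ∀ Γ ∈ 𝒢, ∀ a : M, ∃ Γ' ∈ 𝒢, Γ ≤ Γ' ∧ ∃ b, (a, b) ∈ Γ'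
  back : ∀ Γ ∈ 𝒢, ∀ b : N, ∃ Γ' ∈ 𝒢, Γ ≤ Γ' ∧ ∃ a, (a, b) ∈ Γ'

namespace IsGraphSystem

variable {𝒢 : Set (Submodule R (M × N))}

theorem preimage_converse (h : IsGraphSystem 𝒢) :
    IsGraphSystem (converse ⁻¹' 𝒢 : Set (Submodule R (N × M))) where
  nonempty := let ⟨Γ, hΓ⟩ := h.nonempty; ⟨converse Γ, hΓ⟩
  fst_eq_zero_iff Γ hΓ γ hγ := (h.fst_eq_zero_iff _ hΓ γ.swap hγ).symm
  forth Γ hΓ a := by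
    obtain ⟨Γ', hΓ', hle, b, hb⟩ := h.back _ hΓ a
    exact ⟨converse Γ', hΓ', fun γ hγ => hle (x := γ.swap) hγ, b, hb⟩
  back Γ hΓ a := by
    obtain ⟨Γ', hΓ', hle, b, hb⟩ := h.forth _ hΓ a
    exact ⟨converse Γ', hΓ', fun γ hγ => hle (x := γ.swap) hγ, b, hb⟩

theorem snd_mem_ppow (h : IsGraphSystem 𝒢) (α : Ordinal.{u}) {Γ : Submodule R (M × N)}
    (hΓ : Γ ∈ 𝒢) {γ : M × N} (hγ : γ ∈ Γ) (hα : γ.1 ∈ ppow p α) : γ.2 ∈ ppow p α := by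
  induction α using Ordinal.limitRecOn generalizing Γ γ with
  | zero => simp [ppow_zero]
  | add_one α ih =>
    obtain ⟨y, hy, hyγ⟩ := mem_ppow_add_one.1 hα
    obtain ⟨Γ', hΓ', hle, b, hb⟩ := h.forth Γ hΓ y
    refine mem_ppow_add_one.2 ⟨b, ih hΓ' hb hy, ?_⟩
    have := (h.fst_eq_zero_iff Γ' hΓ' _ (Γ'.sub_mem (Γ'.smul_mem p hb) (hle hγ))).1
      (by simp [hyγ])
    simpa [sub_eq_zero] using this
  | limit α hα' ih =>
    exact (mem_ppow_limit hα').2 fun β hβ => ih β hβ hΓ hγ ((mem_ppow_limit hα').1 hα β hβ)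

theorem mem_ppow_iff (h : IsGraphSystem 𝒢) (α : Ordinal.{u}) {Γ : Submodule R (M × N)}
    (hΓ : Γ ∈ 𝒢) {γ : M × N} (hγ : γ ∈ Γ) : γ.1 ∈ ppow p α ↔ γ.2 ∈ ppow p α :=
  ⟨h.snd_mem_ppow α hΓ hγ,
    h.preimage_converse.snd_mem_ppow (γ := γ.swap) α (Γ := converse Γ) hΓ hγ⟩

theorem pheight_eq (h : IsGraphSystem 𝒢) {Γ : Submodule R (M × N)} (hΓ : Γ ∈ 𝒢) {γ : M × N}
    (hγ : γ ∈ Γ) : pheight p γ.1 = pheight p γ.2 :=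
  le_antisymm (pheight_le_pheight fun α => (h.mem_ppow_iff α hΓ hγ).1)
    (pheight_le_pheight fun α => (h.mem_ppow_iff α hΓ hγ).2)

theorem exists_forth_finset (h : IsGraphSystem 𝒢) {Γ : Submodule R (M × N)} (hΓ : Γ ∈ 𝒢)
    (s : Finset M) : ∃ Γ' ∈ 𝒢, Γ ≤ Γ' ∧ ∃ f : M → N, ∀ a ∈ s, (a, f a) ∈ Γ' := by
  classical
  suffices H : ∃ Γ' ∈ 𝒢, Γ ≤ Γ' ∧ ∀ a ∈ s, ∃ b, (a, b) ∈ Γ' by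
    obtain ⟨Γ', hΓ', hle, hs⟩ := H
    choose! f hf using hs
    exact ⟨Γ', hΓ', hle, f, hf⟩
  induction s using Finset.induction_on with
  | empty => exact ⟨Γ, hΓ, le_rfl, by simp⟩
  | insert a s _ ih =>
    obtain ⟨Γ', hΓ', hle, hs⟩ := ih
    obtain ⟨Γ'', hΓ'', hle', b, hb⟩ := h.forth Γ' hΓ' a
    refine ⟨Γ'', hΓ'', hle.trans hle', fun x hx => ?_⟩
    rcases Finset.mem_insert.1 hx with rfl | hx
    · exact ⟨b, hb⟩
    · exact (hs x hx).imp fun _ h => hle' h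

theorem exists_back_finset (h : IsGraphSystem 𝒢) {Γ : Submodule R (M × N)} (hΓ : Γ ∈ 𝒢)
    (s : Finset N) : ∃ Γ' ∈ 𝒢, Γ ≤ Γ' ∧ ∃ f : N → M, ∀ b ∈ s, (f b, b) ∈ Γ' := by
  obtain ⟨Γ', hΓ', hle, f, hf⟩ :=
    h.preimage_converse.exists_forth_finset (Γ := converse Γ) hΓ s
  exact ⟨converse Γ', hΓ', fun γ hγ => hle (x := γ.swap) hγ, f, hf⟩

theorem exists_family (h : IsGraphSystem 𝒢) {n : ℕ} (u : Fin n → M) :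
    ∃ Γ ∈ 𝒢, ∃ u' : Fin n → N, ∀ i, (u i, u' i) ∈ Γ := by
  classical
  obtain ⟨Γ₀, hΓ₀⟩ := h.nonempty
  obtain ⟨Γ, hΓ, -, f, hf⟩ := h.exists_forth_finset hΓ₀ (Finset.univ.image u)
  exact ⟨Γ, hΓ, fun i => f (u i), fun i => hf _ (Finset.mem_image_of_mem _ (Finset.mem_univ i))⟩

theorem uHat_le (h : IsGraphSystem 𝒢) (hp : ¬ IsUnit p) (α : Ordinal.{u}) (n : ℕ)
    (hn : (n : Cardinal) ≤ uHat p M α) : (n : Cardinal) ≤ uHat p N α := by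
  rw [natCast_le_uHat_iff hp] at hn ⊢
  obtain ⟨u, hu, hi⟩ := hn
  obtain ⟨Γ, hΓ, u', hu'⟩ := h.exists_family u
  refine ⟨u', fun i => ⟨(h.mem_ppow_iff α hΓ (hu' i)).1 (hu i).1, ?_⟩, fun c hc => hi c ?_⟩
  · exact (h.fst_eq_zero_iff Γ hΓ _ (Γ.smul_mem p (hu' i))).1 (hu i).2
  · exact (h.mem_ppow_iff (α + 1) hΓ (sum_smul_mem hu' c)).2 hc

theorem uHatInf_le (h : IsGraphSystem 𝒢) (hp : ¬ IsUnit p) (n : ℕ)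
    (hn : (n : Cardinal) ≤ uHatInf p M) : (n : Cardinal) ≤ uHatInf p N := by
  rw [natCast_le_uHatInf_iff hp] at hn ⊢
  obtain ⟨u, hu, hi⟩ := hn
  obtain ⟨Γ, hΓ, u', hu'⟩ := h.exists_family u
  refine ⟨u', fun i => ⟨(h.pheight_eq hΓ (hu' i)).symm.trans (hu i).1, ?_⟩, fun c hc => hi c ?_⟩
  · exact (h.fst_eq_zero_iff Γ hΓ _ (Γ.smul_mem p (hu' i))).1 (hu i).2
  · exact (h.fst_eq_zero_iff Γ hΓ _ (sum_smul_mem hu' c)).2 hc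

theorem uHat_eq (h : IsGraphSystem 𝒢) (hp : ¬ IsUnit p) (α : Ordinal.{u}) :
    uHat p M α = uHat p N α :=
  eq_of_forall_natCast_le_iff (min_le_right _ _) (min_le_right _ _) fun n =>
    ⟨h.uHat_le hp α n, h.preimage_converse.uHat_le hp α n⟩

theorem uHatInf_eq (h : IsGraphSystem 𝒢) (hp : ¬ IsUnit p) : uHatInf p M = uHatInf p N :=
  eq_of_forall_natCast_le_iff (min_le_right _ _) (min_le_right _ _) fun n =>
    ⟨h.uHatInf_le hp n, h.preimage_converse.uHatInf_le hp n⟩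

end IsGraphSystem

theorem isGraphSystem_graph_id :
    IsGraphSystem {(LinearMap.id : M →ₗ[R] M).graph} where
  nonempty := ⟨_, rfl⟩
  fst_eq_zero_iff := by
    rintro _ rfl γ hγ
    rw [show γ.2 = γ.1 from hγ]
  forth := by
    rintro _ rfl a
    exact ⟨_, rfl, le_rfl, a, rfl⟩
  back := by
    rintro _ rfl a
    exact ⟨_, rfl, le_rfl, a, rfl⟩

end Graphs

section Transfer

variable {R : Type*} [CommRing R] {p : R} {M N : Type u} [AddCommGroup M] [Module R M]
  [AddCommGroup N] [Module R N]

theorem IsPDBWrt.exists_superset {C : Set (Set M)} (hC : IsPDBWrt p C) {X : Set M} (hX : X ∈ C)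
    (s : Finset M) : ∃ Y ∈ C, X ⊆ Y ∧ ∀ a ∈ s, a ∈ hull (Submodule.span R Y) := by
  classical
  induction s using Finset.induction_on with
  | empty => exact ⟨X, hX, le_rfl, by simp⟩
  | insert a s _ ih =>
    obtain ⟨Y, hY, hXY, hs⟩ := ih
    obtain ⟨Z, hZ, hYZ, ha⟩ := hC.2.2.2 Y hY a
    refine ⟨Z, hZ, hXY.trans hYZ, fun x hx => ?_⟩
    rcases Finset.mem_insert.1 hx with rfl | hx
    · exact ha
    · exact hull_mono (Submodule.span_mono hYZ) (hs x hx)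

variable [IsDomain R] [IsDiscreteValuationRing R]

theorem IsGraphSystem.exists_hasAtLeast {𝒢 : Set (Submodule R (M × N))} (h : IsGraphSystem 𝒢)
    (hp : Irreducible p) {C : Set (Set M)} (hC : IsPDBWrt p C) {C' : Set (Set N)}
    (hC' : IsPDBWrt p C') {X : Set M} (hX : X ∈ C) {Y₀ : Set N} (hY₀ : Y₀ ∈ C')
    {e : ℕ → WithTop Ordinal.{u}} {n : ℕ} (hn : HasAtLeast p e n X) :
    ∃ Y ∈ C', Y₀ ⊆ Y ∧ HasAtLeast p e n Y := by
  classical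
  obtain ⟨s, hsX, hcard, hse⟩ := hn
  obtain ⟨Γ₀, hΓ₀⟩ := h.nonempty
  obtain ⟨Γ₁, hΓ₁, -, f, hf⟩ := h.exists_forth_finset hΓ₀ s
  obtain ⟨Y, hY, hY₀Y, hfY⟩ := hC'.exists_superset hY₀ (s.image f)
  have hYfin := hC'.2.1 Y hY
  have := hYfin.fintype
  obtain ⟨Γ, hΓ, hΓ₁Γ, z, hz⟩ := h.exists_back_finset hΓ₁ hYfin.toFinset
  obtain ⟨X₁, hX₁, hXX₁, hzX₁⟩ := hC.exists_superset hX (hYfin.toFinset.image z)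
  have := (hC.2.1 X₁ hX₁).fintype
  replace hz : ∀ y : Y, (z y, (y : N)) ∈ Γ := fun y => hz y (hYfin.mem_toFinset.2 y.2)
  have hx : IsDecompFamily p fun x : X₁ => (x : M) :=
    (hC.2.2.1 X₁ hX₁).isDecompFamily Subtype.val_injective fun x => x.2
  have hy : IsDecompFamily p fun y : Y => (y : N) :=
    (hC'.2.2.1 Y hY).isDecompFamily Subtype.val_injective fun y => y.2
  have hz' : IsDecompFamily p fun y : Y => z y := by
    refine ⟨fun c j => ?_, fun c hc => hy.indep c ?_⟩
    · have h₁ := h.pheight_eq (p := p) hΓ (sum_smul_mem hz c)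
      have h₂ := h.pheight_eq (p := p) hΓ (Γ.smul_mem (c j) (hz j))
      rw [h₁]
      exact (hy.height_le c j).trans_eq h₂.symm
    · exact (h.fst_eq_zero_iff Γ hΓ _ (sum_smul_mem hz c)).1 hc
  have hle := hx.card_le hp hz' (f := fun a : s => (⟨a, hXX₁ (hsX a.2)⟩ : X₁))
    (fun a b hab => Subtype.ext (congrArg (fun x : X₁ => (x : M)) hab))
    (e := e) (fun a => hse a a.2) (fun a => ?_) (fun y => ?_)
  · refine ⟨Y, hY, hY₀Y, (Finset.univ.filter fun y : Y =>
      UlmEquiv (UlmSeqOf p (z y)) e).map ⟨Subtype.val, Subtype.val_injective⟩, ?_, ?_, ?_⟩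
    · intro y hyt
      simp only [Finset.coe_map, Set.mem_image] at hyt
      obtain ⟨y, -, rfl⟩ := hyt
      exact y.2
    · rw [Finset.card_map, ← Fintype.card_subtype]
      rw [Fintype.card_coe] at hle
      exact hcard.trans hle
    · intro y' hy'
      obtain ⟨y, hye, rfl⟩ := Finset.mem_map.1 hy'
      have : UlmSeqOf p (y : N) = UlmSeqOf p (z y) :=
        funext fun i => (h.pheight_eq hΓ (Γ.smul_mem (p ^ i) (hz y))).symm
      rw [Function.Embedding.coeFn_mk, this]
      exact (Finset.mem_filter.1 hye).2
  · obtain ⟨k, hk⟩ := (mem_hull_iff hp).1 (hfY _ (Finset.mem_image_of_mem f a.2))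
    obtain ⟨c, hc⟩ := (Submodule.mem_span_range_iff_exists_fun R).1
      (by rwa [Subtype.range_coe] : p ^ k • f a ∈ Submodule.span R (Set.range fun y : Y => (y : N)))
    refine ⟨k, (Submodule.mem_span_range_iff_exists_fun R).2 ⟨c, ?_⟩⟩
    have := (h.fst_eq_zero_iff Γ hΓ _ (Γ.sub_mem (sum_smul_mem hz c)
      (Γ.smul_mem (p ^ k) (hΓ₁Γ (hf a a.2))))).2 (by simp [hc])
    simpa [sub_eq_zero] using this
  · obtain ⟨k, hk⟩ := (mem_hull_iff hp).1
      (hzX₁ _ (Finset.mem_image_of_mem z (hYfin.mem_toFinset.2 y.2)))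
    exact ⟨k, by rwa [Subtype.range_coe]⟩

theorem IsGraphSystem.wHat_le {𝒢 : Set (Submodule R (M × N))} (h : IsGraphSystem 𝒢)
    (hp : Irreducible p) {C : Set (Set M)} (hC : IsPDBWrt p C) {C' : Set (Set N)}
    (hC' : IsPDBWrt p C') (e : ℕ → WithTop Ordinal.{u}) : wHat p C e ≤ wHat p C' e := by
  refine sSup_le ?_
  rintro _ ⟨n, rfl, X, hX, hn⟩
  obtain ⟨Y₀, hY₀⟩ := hC'.1
  obtain ⟨Y, hY, -, hn'⟩ := h.exists_hasAtLeast hp hC hC' hX hY₀ hn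
  exact le_wHat hY hn'

theorem IsGraphSystem.wHat_eq {𝒢 : Set (Submodule R (M × N))} (h : IsGraphSystem 𝒢)
    (hp : Irreducible p) {C : Set (Set M)} (hC : IsPDBWrt p C) {C' : Set (Set N)}
    (hC' : IsPDBWrt p C') (e : ℕ → WithTop Ordinal.{u}) : wHat p C e = wHat p C' e :=
  le_antisymm (h.wHat_le hp hC hC' e) (h.preimage_converse.wHat_le hp hC' hC e)

end Transfer

section Extension

variable {R : Type*} [CommRing R] {p : R} {M N : Type u} [AddCommGroup M] [Module R M]
  [AddCommGroup N] [Module R N]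

theorem pheight_add_of_eq_top {x : M} (hx : pheight p x = ⊤) (y : M) :
    pheight p (x + y) = pheight p y := by
  refine le_antisymm ?_ (le_pheight_add (by simp [hx]) le_rfl)
  have := le_pheight_sub (p := p) (x := x + y) (y := x) le_rfl (by simp [hx])
  simpa using this

/-- `Γ` is the graph of a height preserving isomorphism between finitely generated submodules. -/
structure IsHeightIso (p : R) (Γ : Submodule R (M × N)) : Prop where
  fg : Γ.FG
  pheight_eq : ∀ γ ∈ Γ, pheight p γ.1 = pheight p γ.2
  fst_eq_zero_iff : ∀ γ ∈ Γ, γ.1 = 0 ↔ γ.2 = 0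

theorem IsHeightIso.converse {Γ : Submodule R (M × N)} (h : IsHeightIso p Γ) :
    IsHeightIso p (converse Γ) where
  fg := by
    rw [UlmW.converse, Submodule.comap_equiv_eq_map_symm]
    exact h.fg.map _
  pheight_eq γ hγ := (h.pheight_eq γ.swap hγ).symm
  fst_eq_zero_iff γ hγ := (h.fst_eq_zero_iff γ.swap hγ).symm

theorem IsHeightIso.fst_eq_iff {Γ : Submodule R (M × N)} (h : IsHeightIso p Γ) {γ γ' : M × N}
    (hγ : γ ∈ Γ) (hγ' : γ' ∈ Γ) : γ.1 = γ'.1 ↔ γ.2 = γ'.2 := by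
  have := h.fst_eq_zero_iff _ (Γ.sub_mem hγ hγ')
  rwa [Prod.fst_sub, Prod.snd_sub, sub_eq_zero, sub_eq_zero] at this

variable [IsDomain R] [IsDiscreteValuationRing R]

theorem isUnit_of_not_dvd (hp : Irreducible p) {c : R} (hc : ¬ p ∣ c) : IsUnit c := by
  obtain ⟨v, n, rfl⟩ := exists_eq_unit_mul_pow hp (c := c) (by rintro rfl; exact hc (dvd_zero p))
  rcases n with _ | n
  · simp
  · exact absurd ((dvd_pow_self p n.succ_ne_zero).mul_left _) hc

/-- Suppose that `Γ` matches submodules `D ≤ E` of `M` with submodules `D' ≤ E'` of `N`. If the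
socle of `E` modulo `D` embeds in that of `E'` modulo `D'`, and the former is not covered by the
domain of `Γ`, then the latter is not covered by the range of `Γ`. -/
theorem exists_socle_not_mem (hp : Irreducible p) {Γ : Submodule R (M × N)} (hΓ : Γ.FG)
    {D E : Submodule R M} {D' E' : Submodule R N} (hDE : D' ≤ E')
    (hE : ∀ γ ∈ Γ, γ.1 ∈ E ↔ γ.2 ∈ E') (hD : ∀ γ ∈ Γ, γ.1 ∈ D ↔ γ.2 ∈ D')
    (hpD : ∀ γ ∈ Γ, (∃ y ∈ D', p • y = γ.2) → ∃ y ∈ D, p • y = γ.1)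
    (hsocle : ∀ n : ℕ, (∃ u : Fin n → M, (∀ i, u i ∈ E ∧ p • u i = 0) ∧ IndepMod p D u) →
      ∃ u : Fin n → N, (∀ i, u i ∈ E' ∧ p • u i = 0) ∧ IndepMod p D' u)
    (hDE₀ : D ≤ E) {u : M} (huE : u ∈ E) (hpu : p • u = 0) (hu : ∀ γ ∈ Γ, u + γ.1 ∉ D) :
    ∃ u' ∈ E', p • u' = 0 ∧ ∀ γ ∈ Γ, u' + γ.2 ∉ D' := by
  let Q : ℕ → Prop := fun n => ∃ γ : Fin n → M × N,
    (∀ i, γ i ∈ Γ ∧ (γ i).1 ∈ E ∧ ∃ y ∈ D, p • y = p • (γ i).1) ∧ IndepMod p D fun i => (γ i).1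
  obtain ⟨n, ⟨γ, hγ, hind⟩, hn⟩ : ∃ n, Q n ∧ ¬ Q (n + 1) := by
    by_contra! hcon
    have hQ : ∀ n, Q n := fun n => by
      induction n with
      | zero => exact ⟨Fin.elim0, fun i => i.elim0, fun _ _ i => i.elim0⟩
      | succ n ih => exact hcon n ih
    obtain ⟨B, hB⟩ := exists_bound_indepMod hp.not_isUnit (hΓ.map (LinearMap.fst R M N)) D
    obtain ⟨γ, hγ, hind⟩ := hQ (B + 1)
    have := hB _ _ (fun i => ⟨Submodule.mem_map_of_mem (hγ i).1, ?_⟩) hind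
    · omega
    · obtain ⟨y, hy, hpy⟩ := (hγ i).2.2
      rw [LinearMap.fst_apply, ← hpy]
      exact D.smul_mem p hy
  choose hγΓ hγE y hyD hpy using hγ
  obtain ⟨v, hv, hvind⟩ := hsocle (n + 1) ⟨Fin.cons u fun i => (γ i).1 - y i, fun i => by
    refine Fin.cases ⟨huE, hpu⟩ (fun i => ?_) i
    rw [Fin.cons_succ]
    exact ⟨E.sub_mem (hγE i) (hDE₀ (hyD i)), by rw [smul_sub, hpy, sub_self]⟩, fun c hc => by
    rw [Fin.sum_univ_succ] at hc
    simp only [Fin.cons_zero, Fin.cons_succ, smul_sub, Finset.sum_sub_distrib] at hc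
    replace hc : c 0 • u + ∑ i : Fin n, c i.succ • (γ i).1 ∈ D := by
      have := D.add_mem hc (D.sum_mem fun i (_ : i ∈ Finset.univ) => D.smul_mem (c i.succ) (hyD i))
      rwa [add_assoc, sub_add_cancel] at this
    have hc0 : p ∣ c 0 := by
      by_contra h0
      obtain ⟨w, hw⟩ := isUnit_of_not_dvd hp h0
      refine hu (∑ i : Fin n, (↑w⁻¹ * c i.succ) • γ i)
        (Γ.sum_mem fun i _ => Γ.smul_mem _ (hγΓ i)) ?_
      have := D.smul_mem (↑w⁻¹ : R) hc
      rw [← hw, smul_add, ← mul_smul, Units.inv_mul, one_smul, Finset.smul_sum] at this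
      simpa [Prod.fst_sum, mul_smul] using this
    refine Fin.cases hc0 fun i => ?_
    obtain ⟨d, hd⟩ := hc0
    rw [hd, mul_comm, mul_smul, hpu, smul_zero, zero_add] at hc
    exact hind (fun i => c i.succ) hc i⟩
  by_contra! hcon
  choose b hbΓ hb using fun j => hcon (v j) (hv j).1 (hv j).2
  refine hn ⟨fun j => b j, fun j => ⟨hbΓ j, (hE _ (hbΓ j)).2 ?_, ?_⟩, fun c hc j => ?_⟩
  · simpa using E'.sub_mem (hDE (hb j)) (hv j).1
  · exact hpD _ (Γ.smul_mem p (hbΓ j)) ⟨_, hb j, by rw [smul_add, (hv j).2, zero_add]; rfl⟩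
  · have h₁ : ∑ j, c j • (b j).2 ∈ D' := by
      have := (hD _ (Γ.sum_mem fun j (_ : j ∈ Finset.univ) => Γ.smul_mem (c j) (hbΓ j))).1
        (by simpa [Prod.fst_sum] using hc)
      simpa [Prod.snd_sum] using this
    refine hvind c ?_ j
    have h₂ := D'.sum_mem fun j (_ : j ∈ Finset.univ) => D'.smul_mem (c j) (hb j)
    simpa [smul_add, Finset.sum_add_distrib] using D'.sub_mem h₂ h₁

variable {Γ : Submodule R (M × N)}

theorem IsHeightIso.exists_socle_of_height (hΓ : IsHeightIso p Γ) (hp : Irreducible p)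
    {α : Ordinal.{u}} (hα : uHat p M α = uHat p N α) {u : M} (hu : α ≤ pheight p u)
    (hpu : p • u = 0) (huΓ : ∀ γ ∈ Γ, pheight p (u + γ.1) ≤ α) :
    ∃ u' : N, α ≤ pheight p u' ∧ p • u' = 0 ∧ ∀ γ ∈ Γ, pheight p (u' + γ.2) ≤ α := by
  have hmem : ∀ (β : Ordinal.{u}), ∀ γ ∈ Γ, γ.1 ∈ ppow p β ↔ γ.2 ∈ ppow p β := fun β γ hγ => by
    rw [← coe_le_pheight, ← coe_le_pheight, hΓ.pheight_eq γ hγ]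
  obtain ⟨u', h₁, h₂, h₃⟩ := exists_socle_not_mem hp hΓ.fg (ppow_add_one_le α) (hmem α)
    (hmem (α + 1))
    (fun γ hγ h => mem_ppow_add_one.1 ((hmem (α + 1 + 1) γ hγ).2 (mem_ppow_add_one.2 h)))
    (fun n h => (natCast_le_uHat_iff hp.not_isUnit α n).1
      (hα ▸ (natCast_le_uHat_iff hp.not_isUnit α n).2 h)) (ppow_add_one_le α)
    (coe_le_pheight.1 hu) hpu fun γ hγ h => (huΓ γ hγ).not_gt (coe_lt_pheight.2 h)
  exact ⟨u', coe_le_pheight.2 h₁, h₂, fun γ hγ => not_lt.1 fun h => h₃ γ hγ (coe_lt_pheight.1 h)⟩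

theorem IsHeightIso.exists_socle_of_top (hΓ : IsHeightIso p Γ) (hp : Irreducible p)
    (hinf : uHatInf p M = uHatInf p N) {u : M} (hu : pheight p u = ⊤)
    (hpu : p • u = 0) (huΓ : ∀ γ ∈ Γ, u + γ.1 ≠ 0) :
    ∃ u' : N, pheight p u' = ⊤ ∧ p • u' = 0 ∧ ∀ γ ∈ Γ, u' + γ.2 ≠ 0 := by
  have hE : ∀ {M : Type u} [AddCommGroup M] [Module R M] (x : M),
      x ∈ ⨅ α : Ordinal.{u}, ppow p α ↔ pheight p x = ⊤ := fun x => by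
    rw [Submodule.mem_iInf, pheight_eq_top]
  obtain ⟨u', h₁, h₂, h₃⟩ := exists_socle_not_mem (E := ⨅ α : Ordinal.{u}, ppow p α)
    (E' := ⨅ α : Ordinal.{u}, ppow p α) (D := ⊥) (D' := ⊥) hp hΓ.fg bot_le
    (fun γ hγ => by rw [hE, hE, hΓ.pheight_eq γ hγ]) hΓ.fst_eq_zero_iff
    (fun γ hγ ⟨y, hy, h⟩ => ⟨0, Submodule.zero_mem _, by
      rw [(Submodule.mem_bot R).1 hy, smul_zero] at h
      rw [smul_zero, (hΓ.fst_eq_zero_iff γ hγ).2 h.symm]⟩)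
    (fun n h => by
      simp only [hE] at h ⊢
      exact (natCast_le_uHatInf_iff hp.not_isUnit n).1
        (hinf ▸ (natCast_le_uHatInf_iff hp.not_isUnit n).2 h))
    bot_le ((hE u).2 hu) hpu huΓ
  exact ⟨u', (hE u').1 h₁, h₂, h₃⟩

theorem IsHeightIso.sup_span (hΓ : IsHeightIso p Γ) (hp : Irreducible p) {z : M × N}
    (hpz : p • z ∈ Γ) (hz : ∀ γ ∈ Γ, pheight p (z.1 + γ.1) = pheight p (z.2 + γ.2))
    (hz₁ : ∀ γ ∈ Γ, z.1 + γ.1 ≠ 0) (hz₂ : ∀ γ ∈ Γ, z.2 + γ.2 ≠ 0) :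
    IsHeightIso p (Γ ⊔ Submodule.span R {z}) := by
  have key : ∀ δ ∈ Γ ⊔ Submodule.span R {z},
      δ ∈ Γ ∨ ∃ γ ∈ Γ, ∃ v : Rˣ, δ = (v : R) • (z + γ) := fun δ hδ => by
    obtain ⟨γ, hγ, ζ, hζ, rfl⟩ := Submodule.mem_sup.1 hδ
    obtain ⟨d, rfl⟩ := Submodule.mem_span_singleton.1 hζ
    by_cases hd : p ∣ d
    · obtain ⟨c, rfl⟩ := hd
      rw [mul_comm, mul_smul]
      exact Or.inl (Γ.add_mem hγ (Γ.smul_mem c hpz))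
    · obtain ⟨v, rfl⟩ := isUnit_of_not_dvd hp hd
      refine Or.inr ⟨(↑v⁻¹ : R) • γ, Γ.smul_mem _ hγ, v, ?_⟩
      rw [smul_add, ← mul_smul, Units.mul_inv, one_smul, add_comm]
  refine ⟨hΓ.fg.sup (Submodule.fg_span_singleton z), fun δ hδ => ?_, fun δ hδ => ?_⟩
  · rcases key δ hδ with h | ⟨γ, hγ, v, rfl⟩
    · exact hΓ.pheight_eq δ h
    · rw [Prod.smul_fst, Prod.smul_snd, pheight_unit_smul, pheight_unit_smul]
      exact hz γ hγ
  · rcases key δ hδ with h | ⟨γ, hγ, v, rfl⟩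
    · exact hΓ.fst_eq_zero_iff δ h
    · rw [Prod.smul_fst, Prod.smul_snd, v.isUnit.smul_eq_zero, v.isUnit.smul_eq_zero]
      exact iff_of_false (hz₁ γ hγ) (hz₂ γ hγ)

/-- Kaplansky's extension step: the domain of a height preserving isomorphism can be enlarged by an
element `g` with `p g` in the domain, if the coset of `g` contains an element of maximal height. -/
theorem IsHeightIso.exists_extension (hΓ : IsHeightIso p Γ) (hp : Irreducible p)
    (hu : ∀ α : Ordinal.{u}, uHat p M α = uHat p N α) (hinf : uHatInf p M = uHatInf p N)
    {g : M} {γ₀ : M × N} (hγ₀ : γ₀ ∈ Γ) (hg : p • g = γ₀.1) (hgΓ : ∀ γ ∈ Γ, g + γ.1 ≠ 0)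
    (hmax : ∃ γ ∈ Γ, ∀ γ' ∈ Γ, pheight p (g + γ'.1) ≤ pheight p (g + γ.1)) :
    ∃ γ ∈ Γ, ∃ w : N, p • (g + γ.1, w) ∈ Γ ∧ IsHeightIso p (Γ ⊔ Submodule.span R {(g + γ.1, w)}) := by
  suffices H : ∃ γ ∈ Γ, ∃ w : N, p • w = γ₀.2 + p • γ.2 ∧
      (∀ γ' ∈ Γ, pheight p (g + γ.1 + γ'.1) = pheight p (w + γ'.2)) ∧
      ∀ γ' ∈ Γ, w + γ'.2 ≠ 0 by
    obtain ⟨γ, hγ, w, hpw, hw, hw₀⟩ := H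
    have hpz : p • (g + γ.1, w) ∈ Γ := by
      have : p • (g + γ.1, w) = γ₀ + p • γ := by
        ext <;> simp [hg, hpw]
      rw [this]
      exact Γ.add_mem hγ₀ (Γ.smul_mem p hγ)
    refine ⟨γ, hγ, w, hpz, hΓ.sup_span hp hpz hw (fun γ' hγ' => ?_) hw₀⟩
    rw [add_assoc]
    exact hgΓ _ (Γ.add_mem hγ hγ')
  obtain ⟨γ, hγ, hmax⟩ := hmax
  cases hα : pheight p (g + γ.1) with
  | coe α =>
    rw [hα] at hmax
    suffices H : ∃ γ ∈ Γ, α ≤ pheight p (g + γ.1) ∧ ∃ w : N, p • w = γ₀.2 + p • γ.2 ∧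
        α ≤ pheight p w ∧ ∀ γ' ∈ Γ, pheight p (w + γ'.2) ≤ α by
      obtain ⟨γ, hγ, hγα, w, hpw, hw, hwΓ⟩ := H
      refine ⟨γ, hγ, w, hpw, fun γ' hγ' => ?_, fun γ' hγ' h0 => ?_⟩
      · have h₁ : pheight p (γ'.1 + (g + γ.1)) ≤ α := by
          rw [← add_assoc, add_comm γ'.1, add_assoc, add_comm γ'.1]
          exact hmax _ (Γ.add_mem hγ hγ')
        have h₂ : pheight p (γ'.2 + w) ≤ α := by
          rw [add_comm]
          exact hwΓ γ' hγ'
        have h₃ : pheight p w = α := le_antisymm (by simpa using hwΓ 0 Γ.zero_mem) hw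
        rw [add_comm _ γ'.1, add_comm _ γ'.2, pheight_add_eq_min (h₁.trans hγα),
          pheight_add_eq_min (h₂.trans hw), h₃, le_antisymm (hmax γ hγ) hγα, hΓ.pheight_eq γ' hγ']
      · have := hwΓ γ' hγ'
        rw [h0, pheight_zero] at this
        exact absurd this (by simp)
    have hγ₁ : ∀ γ ∈ Γ, pheight p (p • (g + γ.1)) = pheight p (γ₀.2 + p • γ.2) := fun γ hγ => by
      rw [smul_add, hg]
      exact hΓ.pheight_eq (γ₀ + p • γ) (Γ.add_mem hγ₀ (Γ.smul_mem p hγ))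
    by_cases hcase : ∃ γ ∈ Γ, α ≤ pheight p (g + γ.1) ∧
        ((α + 1 : Ordinal.{u}) : WithTop Ordinal.{u}) < pheight p (p • (g + γ.1))
    · obtain ⟨γ, hγ, hγα, hlt⟩ := hcase
      have hαα : (α : WithTop Ordinal.{u}) < (α + 1 : Ordinal.{u}) :=
        WithTop.coe_lt_coe.2 (Order.lt_add_one_iff.2 le_rfl)
      obtain ⟨y, hy, hpy⟩ := exists_smul_eq_of_lt_pheight hlt
      obtain ⟨w', hw', hpw'⟩ := exists_smul_eq_of_lt_pheight (hγ₁ γ hγ ▸ hlt)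
      obtain ⟨u', hu', hpu', hu'Γ⟩ := hΓ.exists_socle_of_height hp (hu α) (u := g + γ.1 - y)
        (le_pheight_sub hγα (hαα.le.trans hy)) (by rw [smul_sub, hpy, sub_self])
        (fun γ' hγ' => not_lt.1 fun h => by
          have := (lt_min h (hαα.trans_le hy)).trans_le (min_le_pheight_add _ _)
          rw [sub_add_eq_add_sub, sub_add_cancel, add_assoc] at this
          exact this.not_ge (hmax _ (Γ.add_mem hγ hγ')))
      refine ⟨γ, hγ, hγα, w' + u', by rw [smul_add, hpw', hpu', add_zero],
        le_pheight_add (hαα.le.trans hw') hu', fun γ' hγ' => not_lt.1 fun h => ?_⟩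
      have := (lt_min h (hαα.trans_le (hw'.trans_eq (pheight_neg w').symm))).trans_le
        (min_le_pheight_add _ _)
      rw [show w' + u' + γ'.2 + -w' = u' + γ'.2 by abel] at this
      exact this.not_ge (hu'Γ γ' hγ')
    · push Not at hcase
      obtain ⟨w, hw, hpw⟩ := exists_smul_eq_of_lt_pheight (p := p) (x := γ₀.2 + p • γ.2)
        (α := α) (by
          rw [← hγ₁ γ hγ, ← hα]
          exact pheight_lt_smul (by simp [hα]))
      refine ⟨γ, hγ, hα.ge, w, hpw, hw, fun γ' hγ' => not_lt.1 fun h => ?_⟩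
      have h₁ : α ≤ pheight p γ'.1 := by
        rw [hΓ.pheight_eq γ' hγ']
        simpa using le_pheight_sub h.le hw
      have h₂ : α ≤ pheight p (g + (γ + γ').1) := by
        rw [Prod.fst_add, ← add_assoc]
        exact le_pheight_add hα.ge h₁
      refine (hcase _ (Γ.add_mem hγ hγ') h₂).not_gt ?_
      rw [hγ₁ _ (Γ.add_mem hγ hγ'), coe_lt_pheight, mem_ppow_add_one]
      exact ⟨_, coe_lt_pheight.1 h, by rw [smul_add, hpw, Prod.snd_add, smul_add, add_assoc]⟩
  | top =>
    have hγ₁ : γ₀ + p • γ ∈ Γ := Γ.add_mem hγ₀ (Γ.smul_mem p hγ)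
    have hγ₁g : p • (g + γ.1) = (γ₀ + p • γ).1 := by rw [smul_add, hg]; rfl
    suffices H : ∃ w : N, p • w = γ₀.2 + p • γ.2 ∧ pheight p w = ⊤ ∧ ∀ γ' ∈ Γ, w + γ'.2 ≠ 0 by
      obtain ⟨w, hpw, hw, hwΓ⟩ := H
      refine ⟨γ, hγ, w, hpw, fun γ' hγ' => ?_, hwΓ⟩
      rw [pheight_add_of_eq_top hα, pheight_add_of_eq_top hw, hΓ.pheight_eq γ' hγ']
    by_cases hcase : ∃ γ' ∈ Γ, pheight p γ'.1 = ⊤ ∧ p • γ'.1 = p • (g + γ.1)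
    · obtain ⟨γ', hγ', htop, hpγ'⟩ := hcase
      obtain ⟨u', hu', hpu', hu'Γ⟩ := hΓ.exists_socle_of_top hp hinf (u := g + γ.1 - γ'.1)
        (top_le_iff.1 (le_pheight_sub hα.ge htop.ge)) (by rw [smul_sub, hpγ', sub_self])
        (fun δ hδ => by
          have := hgΓ (γ - γ' + δ) (Γ.add_mem (Γ.sub_mem hγ hγ') hδ)
          rwa [Prod.fst_add, Prod.fst_sub, ← add_assoc, ← add_sub_assoc] at this)
      refine ⟨γ'.2 + u', ?_, ?_, fun δ hδ => ?_⟩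
      · have := (hΓ.fst_eq_iff (Γ.smul_mem p hγ') hγ₁).1 (hpγ'.trans hγ₁g)
        rw [smul_add, hpu', add_zero]
        exact this
      · rw [add_comm, pheight_add_of_eq_top hu', ← hΓ.pheight_eq γ' hγ', htop]
      · have := hu'Γ (γ' + δ) (Γ.add_mem hγ' hδ)
        rwa [Prod.snd_add, ← add_assoc, add_comm u'] at this
    · push Not at hcase
      obtain ⟨w, hw, hpw⟩ := exists_smul_eq_of_pheight_eq_top (p := p) (x := γ₀.2 + p • γ.2) (by
        refine (hΓ.pheight_eq _ hγ₁).symm.trans (top_le_iff.1 ?_)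
        rw [← hγ₁g, ← hα]
        exact pheight_le_smul p _)
      refine ⟨w, hpw, hw, fun γ' hγ' h0 => ?_⟩
      have hw' : w = (-γ').2 := eq_neg_of_add_eq_zero_left h0
      refine hcase (-γ') (Γ.neg_mem hγ') ?_ ?_
      · rw [hΓ.pheight_eq _ (Γ.neg_mem hγ'), ← hw', hw]
      · rw [hγ₁g]
        refine (hΓ.fst_eq_iff (Γ.smul_mem p (Γ.neg_mem hγ')) hγ₁).2 ?_
        rw [Prod.smul_snd, ← hw', hpw]
        rfl

end Extension

section BackAndForth

theorem range_fst_coe {α β : Type*} (P : Finset (α × β)) :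
    (Set.range fun a : P => a.1.1) = Prod.fst '' (P : Set (α × β)) := by
  ext
  simp

variable {R : Type*} [CommRing R] {p : R} {M N : Type u} [AddCommGroup M] [Module R M]
  [AddCommGroup N] [Module R N]

theorem ulmEquiv_of_pheight_eq {x : M} {y : N} {m n : ℕ}
    (h : ∀ i : ℕ, pheight p (p ^ i • p ^ n • x) = pheight p (p ^ i • p ^ m • y)) :
    UlmEquiv (UlmSeqOf p x) (UlmSeqOf p y) := by
  refine ⟨m, n, fun i => ?_⟩
  have := h i
  rwa [← mul_smul, ← mul_smul, ← pow_add, ← pow_add] at this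

/-- Data for the back-and-forth argument: `P` matches a part of the decomposition set `X` of `M`
with a part of the decomposition set `Y` of `N`, and `Γ` is the graph of a height preserving
isomorphism which is commensurable with this matching. -/
structure IsMatching (p : R) (C : Set (Set M)) (C' : Set (Set N)) (X : Set M) (Y : Set N)
    (P : Finset (M × N)) (Γ : Submodule R (M × N)) : Prop extends IsHeightIso p Γ where
  left_mem : X ∈ C
  right_mem : Y ∈ C'
  fst_injOn : Set.InjOn Prod.fst (P : Set (M × N))
  snd_injOn : Set.InjOn Prod.snd (P : Set (M × N))
  fst_mem : ∀ a ∈ P, a.1 ∈ X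
  snd_mem : ∀ a ∈ P, a.2 ∈ Y
  pow_smul_mem : ∀ a ∈ P, ∃ n m : ℕ, (p ^ n • a.1, p ^ m • a.2) ∈ Γ
  fst_mem_span : ∀ γ ∈ Γ, ∃ k : ℕ, p ^ k • γ.1 ∈ Submodule.span R (Prod.fst '' (P : Set (M × N)))
  snd_mem_span : ∀ γ ∈ Γ, ∃ k : ℕ, p ^ k • γ.2 ∈ Submodule.span R (Prod.snd '' (P : Set (M × N)))

variable {C : Set (Set M)} {C' : Set (Set N)} {X : Set M} {Y : Set N} {P : Finset (M × N)}
  {Γ : Submodule R (M × N)}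

theorem IsMatching.converse (h : IsMatching p C C' X Y P Γ) :
    IsMatching p C' C Y X (P.map (Equiv.prodComm M N).toEmbedding) (converse Γ) where
  toIsHeightIso := h.toIsHeightIso.converse
  left_mem := h.right_mem
  right_mem := h.left_mem
  fst_injOn := by
    rintro ⟨a, b⟩ hab ⟨c, d⟩ hcd heq
    have := h.snd_injOn (x₁ := (b, a)) (by simpa using hab) (x₂ := (d, c)) (by simpa using hcd) heq
    simp_all
  snd_injOn := by
    rintro ⟨a, b⟩ hab ⟨c, d⟩ hcd heq
    have := h.fst_injOn (x₁ := (b, a)) (by simpa using hab) (x₂ := (d, c)) (by simpa using hcd) heq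
    simp_all
  fst_mem a ha := by
    obtain ⟨b, hb, rfl⟩ := Finset.mem_map.1 ha
    exact h.snd_mem b hb
  snd_mem a ha := by
    obtain ⟨b, hb, rfl⟩ := Finset.mem_map.1 ha
    exact h.fst_mem b hb
  pow_smul_mem a ha := by
    obtain ⟨b, hb, rfl⟩ := Finset.mem_map.1 ha
    obtain ⟨n, m, hnm⟩ := h.pow_smul_mem b hb
    exact ⟨m, n, hnm⟩
  fst_mem_span γ hγ := by
    rw [Finset.coe_map, Set.image_image]
    exact h.snd_mem_span γ.swap hγ
  snd_mem_span γ hγ := by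
    rw [Finset.coe_map, Set.image_image]
    exact h.fst_mem_span γ.swap hγ

theorem IsMatching.ulmEquiv (h : IsMatching p C C' X Y P Γ) {a : M × N} (ha : a ∈ P) :
    UlmEquiv (UlmSeqOf p a.1) (UlmSeqOf p a.2) := by
  obtain ⟨n, m, hnm⟩ := h.pow_smul_mem a ha
  exact ulmEquiv_of_pheight_eq fun i => h.pheight_eq _ (Γ.smul_mem (p ^ i) hnm)

theorem IsMatching.isDecompFamily (h : IsMatching p C C' X Y P Γ) (hC : IsPDBWrt p C) :
    IsDecompFamily p fun a : P => a.1.1 :=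
  (hC.2.2.1 X h.left_mem).isDecompFamily
    (fun a b hab => Subtype.ext (h.fst_injOn a.2 b.2 hab)) fun a => h.fst_mem a a.2

/-- Replace the isomorphism of a matching by a commensurable extension. -/
theorem IsMatching.of_le (h : IsMatching p C C' X Y P Γ) {Γ' : Submodule R (M × N)}
    (hΓ' : IsHeightIso p Γ') (hle : Γ ≤ Γ') (hpow : ∀ γ ∈ Γ', ∃ k : ℕ, p ^ k • γ ∈ Γ) :
    IsMatching p C C' X Y P Γ' where
  toIsHeightIso := hΓ'
  left_mem := h.left_mem
  right_mem := h.right_mem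
  fst_injOn := h.fst_injOn
  snd_injOn := h.snd_injOn
  fst_mem := h.fst_mem
  snd_mem := h.snd_mem
  pow_smul_mem a ha := (h.pow_smul_mem a ha).imp fun _ ⟨m, hm⟩ => ⟨m, hle hm⟩
  fst_mem_span γ hγ := by
    obtain ⟨k, hk⟩ := hpow γ hγ
    obtain ⟨l, hl⟩ := h.fst_mem_span _ hk
    exact ⟨l + k, by rwa [pow_add, mul_smul]⟩
  snd_mem_span γ hγ := by
    obtain ⟨k, hk⟩ := hpow γ hγ
    obtain ⟨l, hl⟩ := h.snd_mem_span _ hk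
    exact ⟨l + k, by rwa [pow_add, mul_smul]⟩

variable [IsDomain R] [IsDiscreteValuationRing R] [Finite (R ⧸ Ideal.span {p})]

theorem IsMatching.exists_max_pheight (h : IsMatching p C C' X Y P Γ) (hp : Irreducible p)
    (hC : IsPDBWrt p C) {g : M} {k : ℕ} {γ₀ : M × N} (hγ₀ : γ₀ ∈ Γ) (hg : p ^ k • g = γ₀.1) :
    ∃ γ ∈ Γ, ∀ γ' ∈ Γ, pheight p (g + γ'.1) ≤ pheight p (g + γ.1) := by
  obtain ⟨a, ⟨γ, hγ, rfl⟩, hmax⟩ := (h.isDecompFamily hC).exists_max_pheight_of_fg hp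
    (h.fg.map (LinearMap.fst R M N))
    (fun a => by
      obtain ⟨n, m, hnm⟩ := h.pow_smul_mem a a.2
      exact ⟨n, _, hnm, rfl⟩)
    (by
      rintro _ ⟨γ, hγ, rfl⟩
      rw [range_fst_coe]
      exact h.fst_mem_span γ hγ)
    (g := g) (k := k) ⟨γ₀, hγ₀, hg.symm⟩
  exact ⟨γ, hγ, fun γ' hγ' => hmax _ (Submodule.mem_map_of_mem hγ')⟩

theorem IsMatching.exists_extension_of_pow_smul_mem (h : IsMatching p C C' X Y P Γ)
    (hp : Irreducible p) (hC : IsPDBWrt p C)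
    (hu : ∀ α : Ordinal.{u}, uHat p M α = uHat p N α) (hinf : uHatInf p M = uHatInf p N)
    {g : M} {k : ℕ} {γ₀ : M × N} (hγ₀ : γ₀ ∈ Γ) (hg : p ^ k • g = γ₀.1) :
    ∃ Γ', IsMatching p C C' X Y P Γ' ∧ Γ ≤ Γ' ∧ ∃ b, (g, b) ∈ Γ' := by
  induction k generalizing g with
  | zero => exact ⟨Γ, h, le_rfl, γ₀.2, by rwa [← one_smul R g, ← pow_zero p, hg]⟩
  | succ k ih =>
    obtain ⟨Γ₁, h₁, hle₁, b₁, hb₁⟩ := ih (g := p • g) (by rw [← hg, pow_succ, mul_smul])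
    by_cases hgΓ : ∀ γ ∈ Γ₁, g + γ.1 ≠ 0
    · obtain ⟨γ, hγ, w, hpw, hiso⟩ := h₁.toIsHeightIso.exists_extension hp hu hinf hb₁ rfl hgΓ
        (h₁.exists_max_pheight hp hC (k := 1) hb₁ (by rw [pow_one]))
      refine ⟨_, h₁.of_le hiso le_sup_left fun δ hδ => ?_, hle₁.trans le_sup_left, w - γ.2, ?_⟩
      · obtain ⟨ε, hε, ζ, hζ, rfl⟩ := Submodule.mem_sup.1 hδ
        obtain ⟨d, rfl⟩ := Submodule.mem_span_singleton.1 hζ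
        refine ⟨1, ?_⟩
        rw [pow_one, smul_add, smul_comm]
        exact Γ₁.add_mem (Γ₁.smul_mem p hε) (Γ₁.smul_mem d hpw)
      · have := Submodule.sub_mem _ (Submodule.mem_sup_right (Submodule.mem_span_singleton_self
          (R := R) (g + γ.1, w))) (Submodule.mem_sup_left hγ : γ ∈ Γ₁ ⊔ Submodule.span R _)
        rwa [show (g + γ.1, w) - γ = (g, w - γ.2) by ext <;> simp] at this
    · push Not at hgΓ
      obtain ⟨γ, hγ, hgγ⟩ := hgΓ
      refine ⟨Γ₁, h₁, hle₁, (-γ).2, ?_⟩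
      rw [eq_neg_of_add_eq_zero_left hgγ]
      exact Γ₁.neg_mem hγ


theorem IsDecompWrt.exists_forall_pheight_add_eq_min (hX : IsDecompWrt p X) (hp : Irreducible p)
    {ι : Type*} [Fintype ι] {f : ι → M} (hf : Function.Injective f) (hfX : ∀ i, f i ∈ X) {x : M}
    (hx : x ∈ X) (hxf : ∀ i, f i ≠ x) {A : Submodule R M} (hA : A.FG)
    (hAf : ∀ a ∈ A, ∃ k : ℕ, p ^ k • a ∈ Submodule.span R (Set.range f)) :
    ∃ N : ℕ, ∀ n ≥ N, ∀ a ∈ A, ∀ d : R,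
      pheight p (a + d • p ^ n • x) = min (pheight p a) (pheight p (d • p ^ n • x)) ∧
      (a + d • p ^ n • x = 0 → d = 0) := by
  have hopt : IsDecompFamily p fun o : Option ι => o.elim x f := by
    refine hX.isDecompFamily (Option.injective_iff.2 ⟨hf, ?_⟩) ?_
    · rintro ⟨i, hi⟩
      exact hxf i hi
    · rintro (_ | i)
      exacts [hx, hfX i]
  have hsum : ∀ (c : ι → R) (d : R), ∑ o : Option ι, (o.elim d c : R) • (o.elim x f : M) =
      ∑ i, c i • f i + d • x := fun c d => by
    rw [Fintype.sum_option, add_comm]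
    rfl
  obtain ⟨N, hN⟩ := (hX.isDecompFamily hf hfX).exists_forall_pheight_add_le hp hA hAf (z := x)
    (fun s hs d => by
      obtain ⟨c, rfl⟩ := (Submodule.mem_span_range_iff_exists_fun R).1 hs
      rw [← hsum]
      exact hopt.height_le (fun o => o.elim d c) none)
  refine ⟨N, fun n hn a ha d => ⟨pheight_add_eq_min (hN n hn a ha d), fun h0 => ?_⟩⟩
  obtain ⟨k, hk⟩ := hAf a ha
  obtain ⟨c, hc⟩ := (Submodule.mem_span_range_iff_exists_fun R).1 hk
  have h₁ : ∑ i, c i • f i + (p ^ k * d * p ^ n) • x = 0 := by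
    rw [hc, mul_assoc, mul_smul, mul_smul, ← smul_add, h0, smul_zero]
  rw [← hsum] at h₁
  have h₂ : p ^ k * d * p ^ n = 0 := hopt.indep (fun o => o.elim (p ^ k * d * p ^ n) c) h₁ none
  simpa [hp.ne_zero] using h₂

/-- A matching can be enlarged by a pair of elements with equivalent Ulm sequences. -/
theorem IsMatching.exists_insert [DecidableEq (M × N)] (h : IsMatching p C C' X Y P Γ)
    (hp : Irreducible p) (hC : IsPDBWrt p C) (hC' : IsPDBWrt p C') {x : M} {y : N} (hx : x ∈ X)
    (hy : y ∈ Y) (hxP : ∀ a ∈ P, a.1 ≠ x) (hyP : ∀ a ∈ P, a.2 ≠ y)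
    (hxy : UlmEquiv (UlmSeqOf p x) (UlmSeqOf p y)) :
    ∃ Γ', IsMatching p C C' X Y (insert (x, y) P) Γ' ∧ Γ ≤ Γ' := by
  obtain ⟨N₁, hN₁⟩ := (hC.2.2.1 X h.left_mem).exists_forall_pheight_add_eq_min hp
    (f := fun a : P => a.1.1) (fun a b hab => Subtype.ext (h.fst_injOn a.2 b.2 hab))
    (fun a => h.fst_mem a a.2) hx (fun a => hxP a a.2) (h.fg.map (LinearMap.fst R M N))
    (by
      rintro _ ⟨γ, hγ, rfl⟩
      rw [range_fst_coe]
      exact h.fst_mem_span γ hγ)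
  obtain ⟨N₂, hN₂⟩ := (hC'.2.2.1 Y h.right_mem).exists_forall_pheight_add_eq_min hp
    (f := fun a : P => a.1.2) (fun a b hab => Subtype.ext (h.snd_injOn a.2 b.2 hab))
    (fun a => h.snd_mem a a.2) hy (fun a => hyP a a.2) (h.fg.map (LinearMap.snd R M N))
    (by
      rintro _ ⟨γ, hγ, rfl⟩
      rw [show (Set.range fun a : P => a.1.2) = Prod.snd '' (P : Set (M × N)) by ext; simp]
      exact h.snd_mem_span γ hγ)
  obtain ⟨m, n, hmn⟩ := hxy
  obtain ⟨n', m', hn', hm', heq⟩ : ∃ n' m', N₁ ≤ n' ∧ N₂ ≤ m' ∧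
      ∀ i, UlmSeqOf p x (i + n') = UlmSeqOf p y (i + m') :=
    ⟨max N₁ N₂ + n, max N₁ N₂ + m, (le_max_left _ _).trans (Nat.le_add_right _ _),
      (le_max_right _ _).trans (Nat.le_add_right _ _), fun i => by
        rw [← add_assoc, ← add_assoc, hmn]⟩
  have hd : ∀ d : R, pheight p (d • p ^ n' • x) = pheight p (d • p ^ m' • y) := fun d => by
    rcases eq_or_ne d 0 with rfl | hd
    · simp
    obtain ⟨v, i, rfl⟩ := exists_eq_unit_mul_pow hp hd
    rw [pheight_unit_mul_smul, pheight_unit_mul_smul, ← mul_smul, ← mul_smul, ← pow_add, ← pow_add]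
    exact heq i
  set z : M × N := (p ^ n' • x, p ^ m' • y) with hz
  have hmem : ∀ δ ∈ Γ ⊔ Submodule.span R {z}, ∃ γ ∈ Γ, ∃ d : R, δ = γ + d • z := fun δ hδ => by
    obtain ⟨γ, hγ, ζ, hζ, rfl⟩ := Submodule.mem_sup.1 hδ
    obtain ⟨d, rfl⟩ := Submodule.mem_span_singleton.1 hζ
    exact ⟨γ, hγ, d, rfl⟩
  have h₁ := fun γ (hγ : γ ∈ Γ) d => hN₁ n' hn' γ.1 (Submodule.mem_map_of_mem hγ) d
  have h₂ := fun γ (hγ : γ ∈ Γ) d => hN₂ m' hm' γ.2 (Submodule.mem_map_of_mem hγ) d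
  refine ⟨Γ ⊔ Submodule.span R {z}, ⟨⟨h.fg.sup (Submodule.fg_span_singleton z), ?_, ?_⟩,
    h.left_mem, h.right_mem, ?_, ?_, ?_, ?_, ?_, ?_, ?_⟩, le_sup_left⟩
  · intro δ hδ
    obtain ⟨γ, hγ, d, rfl⟩ := hmem δ hδ
    exact (h₁ γ hγ d).1.trans (by rw [h.pheight_eq γ hγ, hd, ← (h₂ γ hγ d).1]; rfl)
  · intro δ hδ
    obtain ⟨γ, hγ, d, rfl⟩ := hmem δ hδ
    constructor
    · intro h0
      have hd0 := (h₁ γ hγ d).2 h0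
      rw [hd0, zero_smul, add_zero] at h0 ⊢
      exact (h.fst_eq_zero_iff γ hγ).1 h0
    · intro h0
      have hd0 := (h₂ γ hγ d).2 h0
      rw [hd0, zero_smul, add_zero] at h0 ⊢
      exact (h.fst_eq_zero_iff γ hγ).2 h0
  · rw [Finset.coe_insert, Set.injOn_insert fun hxyP => hxP _ hxyP rfl]
    exact ⟨h.fst_injOn, fun ⟨a, ha, hax⟩ => hxP a ha hax⟩
  · rw [Finset.coe_insert, Set.injOn_insert fun hxyP => hxP _ hxyP rfl]
    exact ⟨h.snd_injOn, fun ⟨a, ha, hay⟩ => hyP a ha hay⟩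
  · exact Finset.forall_mem_insert _ _ _ |>.2 ⟨hx, h.fst_mem⟩
  · exact Finset.forall_mem_insert _ _ _ |>.2 ⟨hy, h.snd_mem⟩
  · refine Finset.forall_mem_insert _ _ _ |>.2 ⟨⟨n', m', ?_⟩, fun a ha => ?_⟩
    · exact Submodule.mem_sup_right (Submodule.mem_span_singleton_self z)
    · exact (h.pow_smul_mem a ha).imp fun _ ⟨m, hm⟩ => ⟨m, Submodule.mem_sup_left hm⟩
  · intro δ hδ
    obtain ⟨γ, hγ, d, rfl⟩ := hmem δ hδ
    obtain ⟨k, hk⟩ := h.fst_mem_span γ hγ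
    refine ⟨k, ?_⟩
    rw [Finset.coe_insert, Set.image_insert_eq, Prod.fst_add, smul_add]
    refine Submodule.add_mem _ (Submodule.span_mono (Set.subset_insert _ _) hk) ?_
    exact Submodule.smul_mem _ _ (Submodule.smul_mem _ d (Submodule.smul_mem _ _
      (Submodule.subset_span (Set.mem_insert _ _))))
  · intro δ hδ
    obtain ⟨γ, hγ, d, rfl⟩ := hmem δ hδ
    obtain ⟨k, hk⟩ := h.snd_mem_span γ hγ
    refine ⟨k, ?_⟩
    rw [Finset.coe_insert, Set.image_insert_eq, Prod.snd_add, smul_add]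
    refine Submodule.add_mem _ (Submodule.span_mono (Set.subset_insert _ _) hk) ?_
    exact Submodule.smul_mem _ _ (Submodule.smul_mem _ d (Submodule.smul_mem _ _
      (Submodule.subset_span (Set.mem_insert _ _))))

end BackAndForth

section Construction

variable {R : Type*} [CommRing R] {p : R}
  {M N : Type u} [AddCommGroup M] [Module R M] [AddCommGroup N] [Module R N]
  {C : Set (Set M)} {C' : Set (Set N)} {X : Set M} {Y : Set N} {P : Finset (M × N)}
  {Γ : Submodule R (M × N)}

theorem IsMatching.mono (h : IsMatching p C C' X Y P Γ) {X' : Set M} {Y' : Set N} (hX' : X' ∈ C)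
    (hY' : Y' ∈ C') (hXX' : X ⊆ X') (hYY' : Y ⊆ Y') : IsMatching p C C' X' Y' P Γ :=
  { h with
    left_mem := hX'
    right_mem := hY'
    fst_mem := fun a ha => hXX' (h.fst_mem a ha)
    snd_mem := fun a ha => hYY' (h.snd_mem a ha) }

open scoped Classical in
/-- If `Y` has at least as many elements of the class of `x` as `X`, then an element `x` of `X`
which is not yet matched has a possible partner. -/
theorem IsMatching.exists_partner (h : IsMatching p C C' X Y P Γ) (hXfin : X.Finite) {x : M}
    (hx : x ∈ X) (hxP : ∀ a ∈ P, a.1 ≠ x)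
    (hn : HasAtLeast p (UlmSeqOf p x)
      (hXfin.toFinset.filter fun x' => UlmEquiv (UlmSeqOf p x') (UlmSeqOf p x)).card Y) :
    ∃ y ∈ Y, (∀ a ∈ P, a.2 ≠ y) ∧ UlmEquiv (UlmSeqOf p x) (UlmSeqOf p y) := by
  obtain ⟨t, htY, hcard, hte⟩ := hn
  by_contra! hcon
  have ht : ∀ y ∈ t, ∃ a ∈ P, a.2 = y := fun y hy => by
    by_contra! hy'
    exact hcon y (htY hy) hy' (hte y hy).symm
  have hxF : x ∈ hXfin.toFinset.filter fun x' => UlmEquiv (UlmSeqOf p x') (UlmSeqOf p x) :=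
    Finset.mem_filter.2 ⟨hXfin.mem_toFinset.2 hx, UlmEquiv.refl _⟩
  have h₁ : t ⊆ (P.filter fun a => a.2 ∈ t).image Prod.snd := fun y hy => by
    obtain ⟨a, ha, rfl⟩ := ht y hy
    exact Finset.mem_image_of_mem _ (Finset.mem_filter.2 ⟨ha, hy⟩)
  have h₂ : (P.filter fun a => a.2 ∈ t).image Prod.fst ⊆
      (hXfin.toFinset.filter fun x' => UlmEquiv (UlmSeqOf p x') (UlmSeqOf p x)).erase x := by
    intro x' hx'
    obtain ⟨a, ha, rfl⟩ := Finset.mem_image.1 hx'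
    rw [Finset.mem_filter] at ha
    exact Finset.mem_erase.2 ⟨hxP a ha.1, Finset.mem_filter.2
      ⟨hXfin.mem_toFinset.2 (h.fst_mem a ha.1), (h.ulmEquiv ha.1).trans (hte _ ha.2)⟩⟩
  have h₃ := Finset.card_le_card h₂
  rw [Finset.card_image_of_injOn (h.fst_injOn.mono fun a ha => (Finset.mem_filter.1 ha).1)] at h₃
  have h₄ := (Finset.card_le_card h₁).trans Finset.card_image_le
  have h₅ := Finset.card_erase_lt_of_mem hxF
  omega

variable [IsDomain R] [IsDiscreteValuationRing R]

/-- If the invariants `ŵ` of `C` and `C'` agree, then every member of `C'` can be enlarged so as to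
contain at least as many elements of finitely many prescribed classes as a given member of `C`. -/
theorem exists_superset_hasAtLeast (hp : Irreducible p) (hC' : IsPDBWrt p C')
    (hw : ∀ e : ℕ → WithTop Ordinal.{u}, IsUlmSeq e → wHat p C e = wHat p C' e) (hX : X ∈ C)
    (hY : Y ∈ C') (s : Finset M) {n : M → ℕ}
    (hn : ∀ x ∈ s, HasAtLeast p (UlmSeqOf p x) (n x) X) :
    ∃ Y' ∈ C', Y ⊆ Y' ∧ ∀ x ∈ s, HasAtLeast p (UlmSeqOf p x) (n x) Y' := by
  classical
  induction s using Finset.induction_on with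
  | empty => exact ⟨Y, hY, le_rfl, by simp⟩
  | insert a s _ ih =>
    obtain ⟨Y₁, hY₁, hYY₁, hs⟩ := ih fun x hx => hn x (Finset.mem_insert_of_mem hx)
    have hle := le_wHat hX (hn a (Finset.mem_insert_self a s))
    rw [hw _ (isUlmSeq_ulmSeqOf a)] at hle
    obtain ⟨Y₂, hY₂, ha⟩ := exists_hasAtLeast_of_le_wHat hC'.1 hle
    obtain ⟨Y₃, hY₃, hY₁Y₃, ha'⟩ :=
      isGraphSystem_graph_id.exists_hasAtLeast hp hC' hC' hY₂ hY₁ ha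
    refine ⟨Y₃, hY₃, hYY₁.trans hY₁Y₃, fun x hx => ?_⟩
    rcases Finset.mem_insert.1 hx with rfl | hx
    · exact ha'
    · exact (hs x hx).mono hY₁Y₃

variable [Finite (R ⧸ Ideal.span {p})]

theorem IsMatching.exists_forth (h : IsMatching p C C' X Y P Γ) (hp : Irreducible p)
    (hC : IsPDBWrt p C) (hC' : IsPDBWrt p C')
    (hu : ∀ α : Ordinal.{u}, uHat p M α = uHat p N α) (hinf : uHatInf p M = uHatInf p N)
    (hw : ∀ e : ℕ → WithTop Ordinal.{u}, IsUlmSeq e → wHat p C e = wHat p C' e) (g : M) :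
    ∃ X' Y' P' Γ', IsMatching p C C' X' Y' P' Γ' ∧ Γ ≤ Γ' ∧ ∃ b, (g, b) ∈ Γ' := by
  classical
  obtain ⟨X', hX', hXX', hg⟩ := hC.2.2.2 X h.left_mem g
  have hfin := hC.2.1 X' hX'
  obtain ⟨Y', hY', hYY', hcount⟩ := exists_superset_hasAtLeast hp hC' hw hX' h.right_mem
    hfin.toFinset (n := fun x =>
      (hfin.toFinset.filter fun x' => UlmEquiv (UlmSeqOf p x') (UlmSeqOf p x)).card)
    (fun x _ => ⟨_, fun x' hx' => hfin.mem_toFinset.1 (Finset.mem_filter.1 hx').1, le_rfl,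
      fun x' hx' => (Finset.mem_filter.1 hx').2⟩)
  have hstep : ∀ s : Finset M, s ⊆ hfin.toFinset → ∃ P' Γ', IsMatching p C C' X' Y' P' Γ' ∧
      Γ ≤ Γ' ∧ ∀ x ∈ s, ∃ a ∈ P', a.1 = x := fun s hs => by
    induction s using Finset.induction_on with
    | empty => exact ⟨P, Γ, h.mono hX' hY' hXX' hYY', le_rfl, by simp⟩
    | insert x s _ ih =>
      obtain ⟨P₁, Γ₁, h₁, hle, hs₁⟩ := ih ((Finset.subset_insert x s).trans hs)
      by_cases hxP : ∃ a ∈ P₁, a.1 = x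
      · exact ⟨P₁, Γ₁, h₁, hle, Finset.forall_mem_insert _ _ _ |>.2 ⟨hxP, hs₁⟩⟩
      · push Not at hxP
        have hx : x ∈ hfin.toFinset := hs (Finset.mem_insert_self x s)
        obtain ⟨y, hy, hyP, hxy⟩ :=
          h₁.exists_partner hfin (hfin.mem_toFinset.1 hx) hxP (hcount x hx)
        obtain ⟨Γ₂, h₂, hle₂⟩ :=
          h₁.exists_insert hp hC hC' (hfin.mem_toFinset.1 hx) hy hxP hyP hxy
        refine ⟨_, Γ₂, h₂, hle.trans hle₂, Finset.forall_mem_insert _ _ _ |>.2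
          ⟨⟨_, Finset.mem_insert_self _ _, rfl⟩, fun x' hx' => ?_⟩⟩
        obtain ⟨a, ha, rfl⟩ := hs₁ x' hx'
        exact ⟨a, Finset.mem_insert_of_mem ha, rfl⟩
  obtain ⟨P', Γ₁, h₁, hle, hP'⟩ := hstep _ le_rfl
  obtain ⟨k, hk⟩ := (mem_hull_iff hp).1 hg
  obtain ⟨l, γ₀, hγ₀, hl⟩ := exists_pow_smul_mem_trans (p := p)
    (T := Γ₁.map (LinearMap.fst R M N)) rfl
    (fun x hx => by
      obtain ⟨a, ha, rfl⟩ := hP' x (hfin.mem_toFinset.2 hx)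
      obtain ⟨n, m, hnm⟩ := h₁.pow_smul_mem a ha
      exact ⟨n, _, hnm, rfl⟩) hk
  obtain ⟨Γ₂, h₂, hle₂, b, hb⟩ := h₁.exists_extension_of_pow_smul_mem hp hC hu hinf hγ₀
    (g := g) (k := l + k) (by rw [pow_add, mul_smul]; exact hl.symm)
  exact ⟨X', Y', P', Γ₂, h₂, hle.trans hle₂, b, hb⟩

theorem isGraphSystem_of_invariants (hp : Irreducible p) (hC : IsPDBWrt p C)
    (hC' : IsPDBWrt p C')
    (hu : ∀ α : Ordinal.{u}, uHat p M α = uHat p N α) (hinf : uHatInf p M = uHatInf p N)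
    (hw : ∀ e : ℕ → WithTop Ordinal.{u}, IsUlmSeq e → wHat p C e = wHat p C' e) :
    IsGraphSystem {Γ | ∃ X Y P, IsMatching p C C' X Y P Γ} where
  nonempty := by
    obtain ⟨X, hX⟩ := hC.1
    obtain ⟨Y, hY⟩ := hC'.1
    have h0 : ∀ γ ∈ (⊥ : Submodule R (M × N)), γ = 0 := fun γ hγ => (Submodule.mem_bot R).1 hγ
    exact ⟨⊥, X, Y, ∅, {
      fg := Submodule.fg_bot
      pheight_eq := fun γ hγ => by simp [h0 γ hγ]
      fst_eq_zero_iff := fun γ hγ => by simp [h0 γ hγ]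
      left_mem := hX
      right_mem := hY
      fst_injOn := by simp
      snd_injOn := by simp
      fst_mem := by simp
      snd_mem := by simp
      pow_smul_mem := by simp
      fst_mem_span := fun γ hγ => by simp [h0 γ hγ]
      snd_mem_span := fun γ hγ => by simp [h0 γ hγ] }⟩
  fst_eq_zero_iff := fun Γ ⟨_, _, _, h⟩ => h.fst_eq_zero_iff
  forth := by
    rintro Γ ⟨X, Y, P, h⟩ a
    obtain ⟨X', Y', P', Γ', h', hle, hb⟩ := h.exists_forth hp hC hC' hu hinf hw a
    exact ⟨Γ', ⟨X', Y', P', h'⟩, hle, hb⟩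
  back := by
    rintro Γ ⟨X, Y, P, h⟩ b
    obtain ⟨X', Y', P', Γ', h', hle, a, ha⟩ := h.converse.exists_forth hp hC' hC
      (fun α => (hu α).symm) hinf.symm (fun e he => (hw e he).symm) b
    exact ⟨converse Γ', ⟨Y', X', _, h'.converse⟩, fun γ hγ => hle (x := γ.swap) hγ, a, ha⟩

end Construction

section PartialIso

variable {R : Type*} [CommRing R] {M N : Type u} [AddCommGroup M] [Module R M]
  [AddCommGroup N] [Module R N]

theorem IsPartialIsoSystem.isGraphSystem {I : Set (M →ₗ.[R] N)} (hI : IsPartialIsoSystem I) :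
    IsGraphSystem (LinearPMap.graph '' I) where
  nonempty := hI.1.image _
  fst_eq_zero_iff := by
    rintro _ ⟨f, hf, rfl⟩ γ hγ
    obtain ⟨y, hy, hfy⟩ := (LinearPMap.mem_graph_iff _).1 hγ
    rw [← hy, ← hfy, Submodule.coe_eq_zero]
    exact (map_eq_zero_iff f.toFun (hI.2.1 f hf)).symm
  forth := by
    rintro _ ⟨f, hf, rfl⟩ a
    obtain ⟨g, hg, hfg, ha⟩ := hI.2.2.1 f hf a
    exact ⟨_, ⟨g, hg, rfl⟩, LinearPMap.le_graph_of_le hfg, g ⟨a, ha⟩, g.mem_graph ⟨a, ha⟩⟩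
  back := by
    rintro _ ⟨f, hf, rfl⟩ b
    obtain ⟨g, hg, hfg, y, rfl⟩ := hI.2.2.2 f hf b
    exact ⟨_, ⟨g, hg, rfl⟩, LinearPMap.le_graph_of_le hfg, y, g.mem_graph y⟩

theorem IsGraphSystem.isPartialIsoSystem {𝒢 : Set (Submodule R (M × N))}
    (h : IsGraphSystem 𝒢) : IsPartialIsoSystem (LinearPMap.graph ⁻¹' 𝒢) := by
  have hgraph : ∀ Γ ∈ 𝒢, Γ.toLinearPMap.graph = Γ := fun Γ hΓ =>
    Submodule.toLinearPMap_graph_eq Γ fun γ hγ h0 => (h.fst_eq_zero_iff Γ hΓ γ hγ).1 h0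
  refine ⟨?_, fun f hf => ?_, fun f hf a => ?_, fun f hf b => ?_⟩
  · obtain ⟨Γ, hΓ⟩ := h.nonempty
    exact ⟨Γ.toLinearPMap, by rwa [Set.mem_preimage, hgraph Γ hΓ]⟩
  · refine (injective_iff_map_eq_zero f.toFun).2 fun y hy => ?_
    exact Subtype.ext ((h.fst_eq_zero_iff _ hf _ (f.mem_graph y)).2 hy)
  · obtain ⟨Γ, hΓ, hle, b, hb⟩ := h.forth _ hf a
    refine ⟨Γ.toLinearPMap, by rwa [Set.mem_preimage, hgraph Γ hΓ],
      LinearPMap.le_of_le_graph (by rwa [hgraph Γ hΓ]), ?_⟩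
    rw [← hgraph Γ hΓ] at hb
    exact LinearPMap.mem_domain_of_mem_graph hb
  · obtain ⟨Γ, hΓ, hle, a, ha⟩ := h.back _ hf b
    refine ⟨Γ.toLinearPMap, by rwa [Set.mem_preimage, hgraph Γ hΓ],
      LinearPMap.le_of_le_graph (by rwa [hgraph Γ hΓ]), ?_⟩
    rw [← hgraph Γ hΓ] at ha
    obtain ⟨y, -, hy⟩ := (LinearPMap.mem_graph_iff _).1 ha
    exact ⟨y, hy⟩

end PartialIso

section Localization

variable (p : ℤ) [Fact (Prime p)]

instance : IsDiscreteValuationRing (Zp p) :=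
  IsLocalization.AtPrime.isDiscreteValuationRing_of_dedekind_domain ℤ
    (P := Ideal.span {p}) (by
      rw [Ne, Ideal.span_singleton_eq_bot]
      exact (Fact.out : Prime p).ne_zero) _

theorem maximalIdeal_zp : IsLocalRing.maximalIdeal (Zp p) = Ideal.span {(p : Zp p)} := by
  rw [← Localization.AtPrime.map_eq_maximalIdeal, Ideal.map_span, Set.image_singleton]
  simp

theorem irreducible_zp : Irreducible (p : Zp p) :=
  (IsDiscreteValuationRing.irreducible_iff_uniformizer _).2 (maximalIdeal_zp p)

instance : Finite (Zp p ⧸ Ideal.span {(p : Zp p)}) := by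
  have hp : Prime p := Fact.out
  have : (Ideal.span {p} : Ideal ℤ).IsMaximal :=
    PrincipalIdealRing.isMaximal_of_irreducible hp.irreducible
  have : NeZero p.natAbs := ⟨Int.natAbs_ne_zero.2 hp.ne_zero⟩
  rw [← maximalIdeal_zp]
  exact Finite.of_equiv (ZMod p.natAbs) ((Int.quotientSpanEquivZMod p).symm.trans
    (IsLocalization.AtPrime.equivQuotMaximalIdeal (Ideal.span {p}) (Zp p))).toEquiv

end Localization

end UlmW

theorem statement_13 (p : ℤ) [Fact (Prime p)] {G H : Type u} [AddCommGroup G]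
    [Module (Zp p) G] [AddCommGroup H] [Module (Zp p) H]
    (C : Set (Set G)) (hC : IsPDBWrt (p : Zp p) C)
    (C' : Set (Set H)) (hC' : IsPDBWrt (p : Zp p) C') :
    (∃ I : Set (G →ₗ.[Zp p] H), IsPartialIsoSystem I) ↔
      ((∀ α : Ordinal.{u}, uHat (p : Zp p) G α = uHat (p : Zp p) H α) ∧
       uHatInf (p : Zp p) G = uHatInf (p : Zp p) H ∧
       ∀ e : ℕ → WithTop Ordinal.{u}, IsUlmSeq e →
         wHat (p : Zp p) C e = wHat (p : Zp p) C' e) := by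
  have hp := irreducible_zp p
  constructor
  · rintro ⟨I, hI⟩
    have h := hI.isGraphSystem
    exact ⟨h.uHat_eq hp.not_isUnit, h.uHatInf_eq hp.not_isUnit,
      fun e _ => h.wHat_eq hp hC hC' e⟩
  · rintro ⟨hu, hinf, hw⟩
    exact ⟨_, (isGraphSystem_of_invariants hp hC hC' hu hinf hw).isPartialIsoSystem⟩

end
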